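/- For all integers n ≥ 4, r_0(n)² < r_0(n−1)·r_0(n+1), and for all integers n ≥ 19, r_1(n)² < r_1(n−1)·r_1(n+1); here r_0(n) = p̄(n)^{1/n} and r_1(n) = (p̄(n)/n)^{1/n}. -/

import Mathlib

open Real

/-- The overpartition function. -/
noncomputable def pbar (n : ℕ) : ℕ :=
  ∑ k ∈ Finset.range (n + 1),
    (Nat.Partition.distincts k).card * Fintype.card (Nat.Partition (n - k))

/-- `r_α(n) = (p̄(n)/n^α)^(1/n)`. -/
noncomputable def rseq (α : ℝ) (n : ℕ) : ℝ :=
  ((pbar n : ℝ) / (n : ℝ) ^ α) ^ ((n : ℝ)⁻¹)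

section Series

open PowerSeries PowerSeries.WithPiTopology

variable (R : Type*) [CommRing R]

theorem mk_pbar_eq_mul :
    (PowerSeries.mk fun n ↦ (pbar n : R)) =
      (PowerSeries.mk fun n ↦ ((Nat.Partition.distincts n).card : R)) *
        PowerSeries.mk fun n ↦ (Fintype.card (Nat.Partition n) : R) := by
  ext n
  rw [coeff_mul, Finset.Nat.sum_antidiagonal_eq_sum_range_succ_mk]
  simp [pbar]

theorem hasProd_card_partition [TopologicalSpace R] [T2Space R] [IsTopologicalRing R] :
    HasProd (fun i ↦ ∑' j : ℕ, (X : R⟦X⟧) ^ ((i + 1) * j))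
      (PowerSeries.mk fun n ↦ (Fintype.card (Nat.Partition n) : R)) := by
  simpa [Nat.Partition.restricted, Finset.card_univ] using
    Nat.Partition.hasProd_powerSeriesMk_card_restricted R (fun _ ↦ True)

theorem hasProd_card_distincts [TopologicalSpace R] [T2Space R] :
    HasProd (fun i ↦ 1 + (X : R⟦X⟧) ^ (i + 1))
      (PowerSeries.mk fun n ↦ ((Nat.Partition.distincts n).card : R)) := by
  simpa [Nat.Partition.countRestricted_two, Finset.sum_range_succ] using
    Nat.Partition.hasProd_powerSeriesMk_card_countRestricted R (m := 2) (by norm_num)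

theorem hasProd_pbar [TopologicalSpace R] [T2Space R] [IsTopologicalRing R] :
    HasProd (fun i ↦ (1 + (X : R⟦X⟧) ^ (i + 1)) * ∑' j : ℕ, X ^ ((i + 1) * j))
      (PowerSeries.mk fun n ↦ (pbar n : R)) := by
  rw [mk_pbar_eq_mul]
  exact (hasProd_card_distincts R).mul (hasProd_card_partition R)

theorem tsum_X_pow_mul_one_sub [TopologicalSpace R] [T2Space R] [IsTopologicalRing R] (i : ℕ) :
    (∑' j : ℕ, (X : R⟦X⟧) ^ ((i + 1) * j)) * (1 - X ^ (i + 1)) = 1 := by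
  simp_rw [pow_mul]
  exact tsum_pow_mul_one_sub_of_constantCoeff_eq_zero (by simp)

theorem hasProd_expand_pentagonalSeries [TopologicalSpace R] :
    HasProd (fun n ↦ (1 - X ^ (2 * (n + 1)) : R⟦X⟧))
      (expand 2 two_ne_zero (pentagonalSeries R)) := by
  have h := hasProd_one_sub_X_pow R
  rw [HasProd, tendsto_iff_coeff_tendsto] at h ⊢
  intro d
  have key : ∀ s : Finset ℕ, ∏ n ∈ s, (1 - X ^ (2 * (n + 1)) : R⟦X⟧) =
      expand 2 two_ne_zero (∏ n ∈ s, (1 - X ^ (n + 1))) := by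
    intro s
    simp [map_prod, pow_mul, expand_X]
  simp_rw [key, coeff_expand]
  split_ifs with hd
  · exact h _
  · exact tendsto_const_nhds

theorem pbar_series_mul_pentagonalSeries_sq :
    (PowerSeries.mk fun n ↦ (pbar n : ℤ)) * pentagonalSeries ℤ ^ 2 =
      expand 2 two_ne_zero (pentagonalSeries ℤ) := by
  have h := ((hasProd_pbar ℤ).mul (hasProd_one_sub_X_pow ℤ)).mul (hasProd_one_sub_X_pow ℤ)
  rw [sq, ← mul_assoc]
  refine h.unique ?_
  convert hasProd_expand_pentagonalSeries ℤ using 2 with i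
  have := tsum_X_pow_mul_one_sub ℤ i
  linear_combination (1 + (X : ℤ⟦X⟧) ^ (i + 1)) * (1 - X ^ (i + 1)) * this

theorem pentagonalSeries_eq_sum_add (K : ℕ) :
    ∃ A : R⟦X⟧, pentagonalSeries R = ∑ k ∈ Finset.range K,
      (-1) ^ k * (X ^ (k * (3 * k + 1) / 2) - X ^ ((k + 1) * (3 * k + 2) / 2)) +
      X ^ (K * (3 * K + 1) / 2) * A := by
  let _ : TopologicalSpace R := ⊥
  have : DiscreteTopology R := ⟨rfl⟩
  have e1 : ∀ k : ℕ, pentagonal (-(k : ℤ)) = k * (3 * k + 1) / 2 := by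
    intro k
    have := two_mul_natCast_pentagonal_neg (k : ℤ)
    have h2 : 2 * pentagonal (-(k : ℤ)) = k * (3 * k + 1) := by exact_mod_cast this
    omega
  have e2 : ∀ k : ℕ, pentagonal ((k : ℤ) + 1) = (k + 1) * (3 * k + 2) / 2 := by
    intro k
    have := two_mul_natCast_pentagonal ((k : ℤ) + 1)
    have h2 : 2 * pentagonal ((k : ℤ) + 1) = (k + 1) * (3 * k + 2) := by
      zify; rw [this]; ring
    omega
  have h := hasSum_pow_pentagonal_sub_pentagonalSeries R
  simp_rw [e1, e2] at h
  have hdvd : (X : R⟦X⟧) ^ (K * (3 * K + 1) / 2) ∣ pentagonalSeries R - ∑ k ∈ Finset.range K,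
      (-1) ^ k * (X ^ (k * (3 * k + 1) / 2) - X ^ ((k + 1) * (3 * k + 2) / 2)) := by
    rw [X_pow_dvd_iff]
    intro m hm
    rw [map_sub, sub_eq_zero]
    rw [hasSum_iff_hasSum_coeff] at h
    refine (h m).unique ?_
    rw [map_sum]
    refine hasSum_sum_of_ne_finset_zero fun k hk ↦ ?_
    have hk' : K ≤ k := by simpa using hk
    have l1 : K * (3 * K + 1) / 2 ≤ k * (3 * k + 1) / 2 :=
      Nat.div_le_div_right (by gcongr)
    have l2 : K * (3 * K + 1) / 2 ≤ (k + 1) * (3 * k + 2) / 2 :=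
      Nat.div_le_div_right (by gcongr <;> omega)
    exact X_pow_dvd_iff.1 (Dvd.dvd.mul_left (dvd_sub (pow_dvd_pow _ l1) (pow_dvd_pow _ l2)) _) m hm
  obtain ⟨A, hA⟩ := hdvd
  exact ⟨A, by rw [← hA]; ring⟩

end Series

/-- Largeness test for three consecutive values `a, b, c`, valid away from small indices. -/
def convexTest (n a b c : ℕ) : Bool :=
  Nat.blt (n * n * (b * b - a * c) * 10000 + n * (c - a) * c * 10000
    + 13864 * (Nat.log2 n + 1) * (a * c)) (13862 * Nat.log2 b * (a * c))

def powerTestZero (n a b c : ℕ) : Bool :=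
  Nat.blt (b ^ (2 * (n ^ 2 - 1))) (c ^ (n * (n - 1)) * a ^ (n * (n + 1)))

def powerTestOne (n a b c : ℕ) : Bool :=
  Nat.blt (b ^ (2 * (n ^ 2 - 1)) * ((n + 1) ^ (n * (n - 1)) * (n - 1) ^ (n * (n + 1))))
    (c ^ (n * (n - 1)) * a ^ (n * (n + 1)) * n ^ (2 * (n ^ 2 - 1)))

def leafTest (n a b c : ℕ) : Bool :=
  if Nat.ble 143 n then convexTest n a b c
  else if Nat.ble 19 n then powerTestZero n a b c && powerTestOne n a b c
  else powerTestZero n a b c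

def windowTest (B : ℕ) : ℕ → ℕ → ℕ → Bool
  | 0, n, C => leafTest n (C % B) (C / B % B) (C / B ^ 2 % B)
  | d + 1, n, C => windowTest B d n (C % B ^ (2 ^ d + 2)) &&
      windowTest B d (n + 2 ^ d) (C / B ^ (2 ^ d))

/-- Positive and negative parts of the truncated pentagonal series at `x`. -/
def pentPos (x : ℕ) : ℕ → ℕ
  | 0 => 0
  | k + 1 => pentPos x k +
      if k % 2 = 0 then x ^ (k * (3 * k + 1) / 2) else x ^ ((k + 1) * (3 * k + 2) / 2)

def pentNeg (x : ℕ) : ℕ → ℕ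
  | 0 => 0
  | k + 1 => pentNeg x k +
      if k % 2 = 0 then x ^ ((k + 1) * (3 * k + 2) / 2) else x ^ (k * (3 * k + 1) / 2)

/-- Newton iteration for the inverse of `D` modulo `B ^ 2 ^ k`. -/
def newtonInv (B D : ℕ) : ℕ → ℕ
  | 0 => 1
  | k + 1 => newtonInv B D k *
      (B ^ 2 ^ (k + 1) + 2 - D % B ^ 2 ^ (k + 1) * newtonInv B D k % B ^ 2 ^ (k + 1))
        % B ^ 2 ^ (k + 1)

def base : ℕ := 2 ^ 384
def cutoff : ℕ := 6160
def modulus : ℕ := base ^ cutoff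
def eulerTrunc : ℕ := (modulus + pentPos base 65 % modulus - pentNeg base 65 % modulus) % modulus
def eulerSq : ℕ := eulerTrunc * eulerTrunc % modulus
def eulerDouble : ℕ :=
  (modulus + pentPos (base ^ 2) 46 % modulus - pentNeg (base ^ 2) 46 % modulus) % modulus
def packed : ℕ := newtonInv base eulerSq 13 % modulus * eulerDouble % modulus

section Digits

theorem sum_mul_pow_lt {B : ℕ} {f : ℕ → ℕ} {N : ℕ} (hf : ∀ i < N, f i < B) :
    ∑ i ∈ Finset.range N, f i * B ^ i < B ^ N := by
  induction N with
  | zero => simp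
  | succ N ih =>
    rw [Finset.sum_range_succ, pow_succ]
    have h1 := ih fun i hi ↦ hf i (by omega)
    have h2 : f N + 1 ≤ B := hf N (by omega)
    nlinarith [Nat.mul_le_mul_right (B ^ N) h2]

theorem sum_mul_pow_div_mod {B : ℕ} {f : ℕ → ℕ} {N k : ℕ} (hf : ∀ i < N, f i < B) (hk : k < N) :
    (∑ i ∈ Finset.range N, f i * B ^ i) / B ^ k % B = f k := by
  obtain ⟨r, rfl⟩ : ∃ r, N = k + (1 + r) := ⟨N - k - 1, by omega⟩
  have h1 := sum_mul_pow_lt (N := k) (f := f) fun i hi ↦ hf i (by omega)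
  have h2 : ∑ i ∈ Finset.range (k + (1 + r)), f i * B ^ i = ∑ i ∈ Finset.range k, f i * B ^ i +
      B ^ k * (f k + B * ∑ i ∈ Finset.range r, f (k + (1 + i)) * B ^ i) := by
    rw [Finset.sum_range_add, Finset.sum_range_add, Finset.sum_range_one, mul_add, ← mul_assoc,
      Finset.mul_sum]
    congr 2
    · simp [mul_comm]
    · refine Finset.sum_congr rfl fun i _ ↦ ?_
      ring
  have hB : 0 < B := (Nat.zero_le _).trans_lt (hf k hk)
  rw [h2, Nat.add_mul_div_left _ _ (pow_pos hB k), Nat.div_eq_of_lt h1, zero_add,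
    Nat.add_mul_mod_self_left, Nat.mod_eq_of_lt (hf k hk)]

theorem mod_pow_div_pow_mod {B C m j : ℕ} (h : j < m) :
    C % B ^ m / B ^ j % B = C / B ^ j % B := by
  obtain ⟨r, rfl⟩ : ∃ r, m = j + (r + 1) := ⟨m - j - 1, by omega⟩
  rw [pow_add, Nat.mod_mul_right_div_self, pow_succ, Nat.mod_mul_left_mod]

theorem leafTest_of_windowTest {B d n C j : ℕ} (h : windowTest B d n C = true) (hj : j < 2 ^ d) :
    leafTest (n + j) (C / B ^ j % B) (C / B ^ (j + 1) % B) (C / B ^ (j + 2) % B) = true := by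
  induction d generalizing n C j with
  | zero =>
    obtain rfl : j = 0 := by simpa using hj
    simpa [windowTest] using h
  | succ d ih =>
    rw [windowTest, Bool.and_eq_true] at h
    rw [pow_succ] at hj
    by_cases hj' : j < 2 ^ d
    · have := ih h.1 hj'
      rwa [mod_pow_div_pow_mod (by omega), mod_pow_div_pow_mod (by omega),
        mod_pow_div_pow_mod (by omega)] at this
    · have := ih h.2 (j := j - 2 ^ d) (by omega)
      simp only [Nat.div_div_eq_div_mul, ← pow_add] at this
      rwa [show n + 2 ^ d + (j - 2 ^ d) = n + j by omega, show 2 ^ d + (j - 2 ^ d) = j by omega,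
        show 2 ^ d + (j - 2 ^ d + 1) = j + 1 by omega,
        show 2 ^ d + (j - 2 ^ d + 2) = j + 2 by omega] at this

theorem pentPos_sub_pentNeg {R : Type*} [CommRing R] (x K : ℕ) :
    (pentPos x K : R) - pentNeg x K = ∑ k ∈ Finset.range K,
      (-1) ^ k * ((x : R) ^ (k * (3 * k + 1) / 2) - (x : R) ^ ((k + 1) * (3 * k + 2) / 2)) := by
  induction K with
  | zero => simp [pentPos, pentNeg]
  | succ K ih =>
    rw [Finset.sum_range_succ, ← ih, pentPos, pentNeg]
    rcases Nat.mod_two_eq_zero_or_one K with h | h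
    · rw [if_pos h, if_pos h, (Nat.even_iff.2 h).neg_one_pow]
      push_cast
      ring
    · rw [if_neg (by omega), if_neg (by omega), (Nat.odd_iff.2 h).neg_one_pow]
      push_cast
      ring

/-- The pentagonal polynomial with `2 * K` terms, in powers of `X ^ e`. -/
noncomputable def pentPoly (e K : ℕ) : Polynomial ℤ :=
  ∑ k ∈ Finset.range K, (-1) ^ k * ((Polynomial.X ^ e) ^ (k * (3 * k + 1) / 2) -
    (Polynomial.X ^ e) ^ ((k + 1) * (3 * k + 2) / 2))

theorem eval_pentPoly (e B K : ℕ) :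
    (pentPoly e K).eval (B : ℤ) = pentPos (B ^ e) K - pentNeg (B ^ e) K := by
  rw [pentPos_sub_pentNeg, pentPoly, Polynomial.eval_finsetSum]
  simp

theorem pow_dvd_eval_sub {N : ℕ} {p q : Polynomial ℤ}
    (h : (PowerSeries.X : PowerSeries ℤ) ^ N ∣ (p : PowerSeries ℤ) - q) (B : ℤ) :
    B ^ N ∣ p.eval B - q.eval B := by
  have h1 : Polynomial.X ^ N ∣ p - q := by
    rw [Polynomial.X_pow_dvd_iff]
    rw [PowerSeries.X_pow_dvd_iff] at h
    intro d hd
    simpa using h d hd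
  obtain ⟨r, hr⟩ := h1
  exact ⟨r.eval B, by rw [← Polynomial.eval_sub, hr]; simp⟩

theorem sum_pbar_mul_pent_modEq {N K L : ℕ} (hK : N ≤ K * (3 * K + 1) / 2)
    (hL : N ≤ 2 * (L * (3 * L + 1) / 2)) (B : ℕ) :
    (B : ℤ) ^ N ∣ (∑ n ∈ Finset.range N, pbar n * B ^ n) *
      ((pentPos B K : ℤ) - pentNeg B K) ^ 2 - ((pentPos (B ^ 2) L : ℤ) - pentNeg (B ^ 2) L) := by
  obtain ⟨A, hA⟩ := pentagonalSeries_eq_sum_add ℤ K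
  obtain ⟨A', hA'⟩ := pentagonalSeries_eq_sum_add ℤ L
  set P : PowerSeries ℤ := PowerSeries.mk fun n ↦ (pbar n : ℤ) with hP
  have h1 : (PowerSeries.X : PowerSeries ℤ) ^ N ∣ P - (P.trunc N : Polynomial ℤ) := by
    rw [PowerSeries.X_pow_dvd_iff]
    intro m hm
    rw [map_sub, Polynomial.coeff_coe, PowerSeries.coeff_trunc, if_pos hm, sub_self]
  have h2 : (PowerSeries.X : PowerSeries ℤ) ^ N ∣
      PowerSeries.pentagonalSeries ℤ - (pentPoly 1 K : Polynomial ℤ) := by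
    have : (pentPoly 1 K : PowerSeries ℤ) = ∑ k ∈ Finset.range K,
        (-1) ^ k * (PowerSeries.X ^ (k * (3 * k + 1) / 2) -
          PowerSeries.X ^ ((k + 1) * (3 * k + 2) / 2)) := by
      rw [pentPoly, ← Polynomial.coeToPowerSeries.ringHom_apply]
      simp [map_sum]
    rw [hA, this, add_sub_cancel_left]
    exact (pow_dvd_pow _ hK).mul_right _
  have h3 : (PowerSeries.X : PowerSeries ℤ) ^ N ∣
      PowerSeries.expand 2 two_ne_zero (PowerSeries.pentagonalSeries ℤ) -
        (pentPoly 2 L : Polynomial ℤ) := by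
    have : (pentPoly 2 L : PowerSeries ℤ) = PowerSeries.expand 2 two_ne_zero
        (∑ k ∈ Finset.range L, (-1) ^ k * (PowerSeries.X ^ (k * (3 * k + 1) / 2) -
          PowerSeries.X ^ ((k + 1) * (3 * k + 2) / 2))) := by
      rw [pentPoly, ← Polynomial.coeToPowerSeries.ringHom_apply]
      simp [map_sum, PowerSeries.expand_X]
    rw [hA', this, map_add, add_sub_cancel_left, map_mul, map_pow, PowerSeries.expand_X, ← pow_mul]
    exact (pow_dvd_pow _ hL).mul_right _
  have h4 := pow_dvd_eval_sub (p := P.trunc N * pentPoly 1 K ^ 2) (q := pentPoly 2 L) (N := N)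
    (by
      have hm := pbar_series_mul_pentagonalSeries_sq
      rw [← hP] at hm
      rw [← Polynomial.coeToPowerSeries.ringHom_apply, map_mul, map_pow,
        Polynomial.coeToPowerSeries.ringHom_apply, Polynomial.coeToPowerSeries.ringHom_apply]
      obtain ⟨a, ha⟩ := h1
      obtain ⟨b, hb⟩ := h2
      obtain ⟨c, hc⟩ := h3
      refine ⟨c - a * (pentPoly 1 K : PowerSeries ℤ) ^ 2 - P * b *
        (PowerSeries.pentagonalSeries ℤ + (pentPoly 1 K : PowerSeries ℤ)), ?_⟩
      linear_combination hc + hm - ha * (pentPoly 1 K : PowerSeries ℤ) ^ 2 - P * hb *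
        (PowerSeries.pentagonalSeries ℤ + (pentPoly 1 K : PowerSeries ℤ))) B
  rw [Polynomial.eval_mul, Polynomial.eval_pow, eval_pentPoly, eval_pentPoly, pow_one] at h4
  convert h4 using 3
  rw [Polynomial.eval, PowerSeries.eval₂_trunc_eq_sum_range]
  simp [hP]

end Digits

section Computation

theorem sub_mod_modEq {m : ℕ} (hm : 0 < m) (a b : ℕ) :
    (((m + a % m - b % m) % m : ℕ) : ℤ) ≡ a - b [ZMOD m] := by
  have h : b % m ≤ m + a % m := (Nat.mod_lt b hm).le.trans (Nat.le_add_right _ _)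
  rw [Int.natCast_mod, Nat.cast_sub h, Nat.cast_add, Int.natCast_mod, Int.natCast_mod]
  refine (Int.mod_modEq _ _).trans ?_
  refine Int.ModEq.sub ?_ (Int.mod_modEq _ _)
  simpa using (Int.modEq_zero_iff_dvd.2 (dvd_refl (m : ℤ))).add (Int.mod_modEq (a : ℤ) m)

theorem eq_sum_pbar {B N M K L T S D Q : ℕ} (hM : M = B ^ N)
    (hK : N ≤ K * (3 * K + 1) / 2) (hL : N ≤ 2 * (L * (3 * L + 1) / 2))
    (hT : T = (M + pentPos B K % M - pentNeg B K % M) % M) (hS : S = T * T % M)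
    (hD : D = (M + pentPos (B ^ 2) L % M - pentNeg (B ^ 2) L % M) % M)
    (hQ : Q * S % M = D) (hQM : Q < M) (hcop : S.Coprime B) (hlt : ∀ n < N, pbar n < B) :
    Q = ∑ n ∈ Finset.range N, pbar n * B ^ n := by
  have hM0 : 0 < M := (Nat.zero_le _).trans_lt hQM
  have hsum := sum_mul_pow_lt hlt
  rw [← hM] at hsum
  have h1 : (T : ℤ) ≡ pentPos B K - pentNeg B K [ZMOD M] := hT ▸ sub_mod_modEq hM0 _ _
  have h2 : (D : ℤ) ≡ pentPos (B ^ 2) L - pentNeg (B ^ 2) L [ZMOD M] := hD ▸ sub_mod_modEq hM0 _ _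
  have h3 : (S : ℤ) ≡ T ^ 2 [ZMOD M] := by
    rw [hS, Int.natCast_mod, Nat.cast_mul, sq]
    exact Int.mod_modEq _ _
  have h4 : ((Q * S : ℕ) : ℤ) ≡ D [ZMOD M] := by
    rw [← hQ, Int.natCast_mod]
    exact (Int.mod_modEq _ _).symm
  have h5 : ((∑ n ∈ Finset.range N, pbar n * B ^ n : ℕ) : ℤ) *
      ((pentPos B K : ℤ) - pentNeg B K) ^ 2 ≡
      pentPos (B ^ 2) L - pentNeg (B ^ 2) L [ZMOD M] := by
    refine (Int.modEq_iff_dvd.2 ?_).symm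
    rw [hM, Nat.cast_pow]
    exact sum_pbar_mul_pent_modEq hK hL B
  have h6 : Q * S ≡ (∑ n ∈ Finset.range N, pbar n * B ^ n) * S [MOD M] := by
    rw [← Int.natCast_modEq_iff]
    refine (h4.trans h2).trans (h5.symm.trans ?_)
    rw [Nat.cast_mul]
    exact Int.ModEq.mul_left _ ((h1.pow 2).symm.trans h3.symm)
  have h7 : M.gcd S = 1 := by
    rw [hM]
    exact (hcop.pow_right N).symm
  exact (h6.cancel_right_of_coprime h7).eq_of_lt_of_lt hQM hsum

theorem packed_mul_eulerSq : packed * eulerSq % modulus = eulerDouble := by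
  decide +kernel

theorem eulerSq_mod_two : eulerSq % 2 = 1 := by
  decide +kernel

theorem windowTest_packed_low : windowTest base 12 4 (packed / base ^ 3) = true := by
  decide +kernel

theorem windowTest_packed_high : windowTest base 11 4100 (packed / base ^ 4099) = true := by
  decide +kernel

theorem packed_eq (hlt : ∀ n < cutoff, pbar n < base) :
    packed = ∑ n ∈ Finset.range cutoff, pbar n * base ^ n := by
  have hB0 : 0 < base := Nat.two_pow_pos 384
  have hM0 : 0 < modulus := pow_pos hB0 cutoff
  have hcop : eulerSq.Coprime base :=
    (Nat.coprime_two_right.2 (Nat.odd_iff.2 eulerSq_mod_two)).pow_right 384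
  refine eq_sum_pbar (K := 65) (L := 46) modulus.eq_1 ?_ ?_ eulerTrunc.eq_1 eulerSq.eq_1
    eulerDouble.eq_1 packed_mul_eulerSq ?_ hcop hlt
  · norm_num [cutoff]
  · norm_num [cutoff]
  · rw [packed]
    exact Nat.mod_lt _ hM0

theorem leafTest_pbar (hlt : ∀ n < cutoff, pbar n < base) {n : ℕ} (h4 : 4 ≤ n) (hn : n < 6148) :
    leafTest n (pbar (n - 1)) (pbar n) (pbar (n + 1)) = true := by
  have hdig : ∀ k < 6160, packed / base ^ k % base = pbar k := by
    intro k hk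
    rw [packed_eq hlt]
    exact sum_mul_pow_div_mod hlt hk
  by_cases h : n < 4100
  · have := leafTest_of_windowTest windowTest_packed_low (j := n - 4) (by norm_num; omega)
    simp only [Nat.div_div_eq_div_mul, ← pow_add] at this
    rwa [hdig _ (by omega), hdig _ (by omega), hdig _ (by omega),
      show 4 + (n - 4) = n by omega, show 3 + (n - 4) = n - 1 by omega,
      show 3 + (n - 4 + 1) = n by omega, show 3 + (n - 4 + 2) = n + 1 by omega] at this
  · have := leafTest_of_windowTest windowTest_packed_high (j := n - 4100) (by norm_num; omega)
    simp only [Nat.div_div_eq_div_mul, ← pow_add] at this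
    rwa [hdig _ (by omega), hdig _ (by omega), hdig _ (by omega),
      show 4100 + (n - 4100) = n by omega, show 4099 + (n - 4100) = n - 1 by omega,
      show 4099 + (n - 4100 + 1) = n by omega, show 4099 + (n - 4100 + 2) = n + 1 by omega] at this

end Computation

section LogForm

theorem pbar_pos (n : ℕ) : 0 < pbar n := by
  refine lt_of_lt_of_le ?_ (Finset.single_le_sum (f := fun k ↦
    (Nat.Partition.distincts k).card * Fintype.card (Nat.Partition (n - k)))
    (fun _ _ ↦ Nat.zero_le _) (Finset.mem_range.2 n.succ_pos))
  refine Nat.mul_pos (Finset.card_pos.2 ⟨default, ?_⟩) Fintype.card_pos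
  simp [Nat.Partition.distincts]

theorem log_rseq (α : ℝ) {n : ℕ} (hn : 0 < n) :
    log (rseq α n) = (log (pbar n) - α * log n) / n := by
  have h1 : (0 : ℝ) < pbar n := by exact_mod_cast pbar_pos n
  have h2 : (0 : ℝ) < n := by exact_mod_cast hn
  rw [rseq, log_rpow (div_pos h1 (rpow_pos_of_pos h2 _)), log_div h1.ne' (rpow_pos_of_pos h2 _).ne',
    log_rpow h2]
  field_simp

theorem rseq_pos (α : ℝ) {n : ℕ} (hn : 0 < n) : 0 < rseq α n := by
  have h1 : (0 : ℝ) < pbar n := by exact_mod_cast pbar_pos n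
  have h2 : (0 : ℝ) < n := by exact_mod_cast hn
  rw [rseq]
  positivity

theorem rseq_sq_lt_of_log {α : ℝ} {n : ℕ} (hn : 2 ≤ n)
    (h : 2 * ((n : ℝ) ^ 2 - 1) * (log (pbar n) - α * log n) <
      n * (n + 1) * (log (pbar (n - 1)) - α * log (n - 1)) +
      n * (n - 1) * (log (pbar (n + 1)) - α * log (n + 1))) :
    rseq α n ^ 2 < rseq α (n - 1) * rseq α (n + 1) := by
  have hn' : (2 : ℝ) ≤ n := by exact_mod_cast hn
  have p0 := rseq_pos α (show 0 < n by omega)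
  have p1 := rseq_pos α (show 0 < n - 1 by omega)
  have p2 := rseq_pos α (show 0 < n + 1 by omega)
  rw [← log_lt_log_iff (by positivity) (by positivity), log_pow, log_mul p1.ne' p2.ne',
    log_rseq α (by omega), log_rseq α (by omega), log_rseq α (by omega)]
  push_cast [show 1 ≤ n by omega]
  generalize log (pbar n) - α * log n = x at *
  generalize log (pbar (n - 1)) - α * log (n - 1) = y at *
  generalize log (pbar (n + 1)) - α * log (n + 1) = z at *
  have hm : (0 : ℝ) < n - 1 := by linarith
  rw [← sub_pos]
  have : y / (n - 1 : ℝ) + z / (n + 1 : ℝ) - 2 * (x / n) =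
      (n * (n + 1) * y + n * (n - 1) * z - 2 * ((n : ℝ) ^ 2 - 1) * x) /
        (n * (n - 1) * (n + 1)) := by
    field_simp
    ring
  rw [this]
  exact div_pos (by linarith) (by positivity)

/-- A sufficient condition on second differences of `log (pbar n)`. -/
theorem rseq_sq_lt_of_gap {n : ℕ} (hn : 2 ≤ n)
    (h : 2 * log n < (n : ℝ) ^ 2 * (log (pbar (n + 1)) + log (pbar (n - 1)) - 2 * log (pbar n)) -
      n * (log (pbar (n + 1)) - log (pbar (n - 1))) + 2 * log (pbar n)) :
    rseq 0 n ^ 2 < rseq 0 (n - 1) * rseq 0 (n + 1) ∧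
      rseq 1 n ^ 2 < rseq 1 (n - 1) * rseq 1 (n + 1) := by
  have hn' : (2 : ℝ) ≤ n := by exact_mod_cast hn
  have h0 : 0 ≤ log n := log_nonneg (by linarith)
  have h1 : log (n - 1) ≤ log (n + 1) := log_le_log (by linarith) (by linarith)
  have h2 : log (n - 1) + log (n + 1) ≤ 2 * log n := by
    rw [← log_mul (by linarith) (by linarith), ← Nat.cast_ofNat, ← log_pow]
    exact log_le_log (by nlinarith) (by nlinarith)
  constructor <;> apply rseq_sq_lt_of_log hn
  · nlinarith
  · have e1 := mul_le_mul_of_nonneg_left h1 (show (0 : ℝ) ≤ n by linarith)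
    have e2 := mul_le_mul_of_nonneg_left h2 (sq_nonneg (n : ℝ))
    nlinarith

theorem rseq_zero_of_powerTestZero {n : ℕ} (hn : 2 ≤ n)
    (h : powerTestZero n (pbar (n - 1)) (pbar n) (pbar (n + 1)) = true) :
    rseq 0 n ^ 2 < rseq 0 (n - 1) * rseq 0 (n + 1) := by
  apply rseq_sq_lt_of_log hn
  rw [powerTestZero, Nat.blt_eq, ← Nat.cast_lt (α := ℝ)] at h
  have p0 : (0 : ℝ) < pbar n := by exact_mod_cast pbar_pos n
  have p1 : (0 : ℝ) < pbar (n - 1) := by exact_mod_cast pbar_pos (n - 1)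
  have p2 : (0 : ℝ) < pbar (n + 1) := by exact_mod_cast pbar_pos (n + 1)
  push_cast at h
  have r0 := pow_pos p0 (2 * (n ^ 2 - 1))
  have r1 := pow_pos p1 (n * (n + 1))
  have r2 := pow_pos p2 (n * (n - 1))
  rw [← log_lt_log_iff r0 (mul_pos r2 r1), log_mul r2.ne' r1.ne', log_pow, log_pow, log_pow] at h
  push_cast [show 1 ≤ n by omega, show 1 ≤ n ^ 2 from Nat.one_le_pow _ _ (by omega)] at h
  linarith

theorem rseq_one_of_powerTestOne {n : ℕ} (hn : 2 ≤ n)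
    (h : powerTestOne n (pbar (n - 1)) (pbar n) (pbar (n + 1)) = true) :
    rseq 1 n ^ 2 < rseq 1 (n - 1) * rseq 1 (n + 1) := by
  apply rseq_sq_lt_of_log hn
  rw [powerTestOne, Nat.blt_eq, ← Nat.cast_lt (α := ℝ)] at h
  have p0 : (0 : ℝ) < pbar n := by exact_mod_cast pbar_pos n
  have p1 : (0 : ℝ) < pbar (n - 1) := by exact_mod_cast pbar_pos (n - 1)
  have p2 : (0 : ℝ) < pbar (n + 1) := by exact_mod_cast pbar_pos (n + 1)
  have q0 : (0 : ℝ) < n := by exact_mod_cast (show 0 < n by omega)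
  have q1 : (0 : ℝ) < (n - 1 : ℕ) := by exact_mod_cast (show 0 < n - 1 by omega)
  push_cast [-Nat.cast_pred, -Nat.cast_sub] at h
  have q2 : (0 : ℝ) < n + 1 := by linarith
  have r0 := pow_pos p0 (2 * (n ^ 2 - 1))
  have r1 := pow_pos p1 (n * (n + 1))
  have r2 := pow_pos p2 (n * (n - 1))
  have s0 := pow_pos q0 (2 * (n ^ 2 - 1))
  have s1 := pow_pos q1 (n * (n + 1))
  have s2 := pow_pos q2 (n * (n - 1))
  rw [← log_lt_log_iff (mul_pos r0 (mul_pos s2 s1)) (mul_pos (mul_pos r2 r1) s0),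
    log_mul r0.ne' (mul_pos s2 s1).ne', log_mul s2.ne' s1.ne', log_mul (mul_pos r2 r1).ne' s0.ne',
    log_mul r2.ne' r1.ne', log_pow, log_pow, log_pow, log_pow, log_pow, log_pow] at h
  push_cast [show 1 ≤ n by omega, show 1 ≤ n ^ 2 from Nat.one_le_pow _ _ (by omega)] at h
  linarith

theorem gap_of_convexTest {n : ℕ} (hn : 2 ≤ n)
    (h : convexTest n (pbar (n - 1)) (pbar n) (pbar (n + 1)) = true) :
    2 * log n < (n : ℝ) ^ 2 * (log (pbar (n + 1)) + log (pbar (n - 1)) - 2 * log (pbar n)) -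
      n * (log (pbar (n + 1)) - log (pbar (n - 1))) + 2 * log (pbar n) := by
  have p0 : (0 : ℝ) < pbar n := by exact_mod_cast pbar_pos n
  have p1 : (0 : ℝ) < pbar (n - 1) := by exact_mod_cast pbar_pos (n - 1)
  have p2 : (0 : ℝ) < pbar (n + 1) := by exact_mod_cast pbar_pos (n + 1)
  have hb : pbar n ≠ 0 := (pbar_pos n).ne'
  have q0 : (2 : ℝ) ≤ n := by exact_mod_cast hn
  generalize pbar (n - 1) = a at *
  generalize pbar n = b at *
  generalize pbar (n + 1) = c at *
  rw [convexTest, Nat.blt_eq, ← Nat.cast_lt (α := ℝ)] at h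
  push_cast [-Nat.cast_sub] at h
  have hu : (b : ℝ) * b - a * c ≤ (b * b - a * c : ℕ) := by
    rw [sub_le_iff_le_add]
    exact_mod_cast (le_tsub_add : b * b ≤ b * b - a * c + a * c)
  have hv : (c : ℝ) - a ≤ (c - a : ℕ) := by
    rw [sub_le_iff_le_add]
    exact_mod_cast (le_tsub_add : c ≤ c - a + a)
  generalize ((b * b - a * c : ℕ) : ℝ) = u at *
  generalize ((c - a : ℕ) : ℝ) = v at *
  have l1 : -u / (a * c) ≤ log c + log a - 2 * log b := by
    have e := one_sub_inv_le_log_of_pos (x := (a * c : ℝ) / b ^ 2) (by positivity)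
    rw [log_div (by positivity) (by positivity), log_mul p1.ne' p2.ne', log_pow] at e
    have : -u / (a * c) ≤ 1 - ((a * c : ℝ) / b ^ 2)⁻¹ := by
      rw [inv_div, one_sub_div (by positivity)]
      gcongr
      linarith
    push_cast at e
    linarith
  have l2 : log c - log a ≤ v * c / (a * c) := by
    have e := log_le_sub_one_of_pos (x := (c : ℝ) / a) (by positivity)
    rw [log_div p2.ne' p1.ne', div_sub_one p1.ne'] at e
    refine e.trans ?_
    rw [mul_div_mul_right _ _ p2.ne']
    gcongr
  have l3 : (Nat.log2 b : ℝ) * 0.6931 ≤ log b := by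
    have e : ((2 ^ Nat.log2 b : ℕ) : ℝ) ≤ b := by exact_mod_cast Nat.log2_self_le hb
    have := log_le_log (by positivity) e
    rw [Nat.cast_pow, log_pow] at this
    have h2 := log_two_gt_d9
    push_cast at this
    nlinarith [(Nat.cast_nonneg (Nat.log2 b) : (0 : ℝ) ≤ _)]
  have l4 : log n ≤ ((Nat.log2 n : ℝ) + 1) * 0.6932 := by
    have e : (n : ℝ) ≤ ((2 ^ (Nat.log2 n + 1) : ℕ) : ℝ) := by
      exact_mod_cast (Nat.lt_log2_self (n := n)).le
    have := log_le_log (by positivity) e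
    rw [Nat.cast_pow, log_pow] at this
    have h2 := log_two_lt_d9
    push_cast at this
    nlinarith [(Nat.cast_nonneg (Nat.log2 n) : (0 : ℝ) ≤ _)]
  have l5 : n ^ 2 * (u / (a * c)) + n * (v * c / (a * c)) + 1.3864 * (Nat.log2 n + 1) <
      1.3862 * Nat.log2 b := by
    have hac : (0 : ℝ) < a * c := by positivity
    have : n ^ 2 * (u / (a * c)) + n * (v * c / (a * c)) + 1.3864 * (Nat.log2 n + 1) =
      (n * n * u * 10000 + n * v * c * 10000 + 13864 * (Nat.log2 n + 1) * (a * c)) /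
        (10000 * (a * c)) := by
      field_simp
      ring
    rw [this, div_lt_iff₀ (by positivity)]
    linarith
  rw [neg_div] at l1
  have m1 := mul_le_mul_of_nonneg_left l1 (sq_nonneg (n : ℝ))
  have m2 := mul_le_mul_of_nonneg_left l2 (show (0 : ℝ) ≤ n by linarith)
  linarith

theorem rseq_of_leafTest {n : ℕ} (hn : 2 ≤ n)
    (h : leafTest n (pbar (n - 1)) (pbar n) (pbar (n + 1)) = true) :
    rseq 0 n ^ 2 < rseq 0 (n - 1) * rseq 0 (n + 1) ∧
      (19 ≤ n → rseq 1 n ^ 2 < rseq 1 (n - 1) * rseq 1 (n + 1)) := by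
  rw [leafTest] at h
  split_ifs at h with h1 h2
  · have := rseq_sq_lt_of_gap hn (gap_of_convexTest hn h)
    exact ⟨this.1, fun _ ↦ this.2⟩
  · rw [Bool.and_eq_true] at h
    exact ⟨rseq_zero_of_powerTestZero hn h.1, fun _ ↦ rseq_one_of_powerTestOne hn h.2⟩
  · rw [Nat.ble_eq] at h2
    exact ⟨rseq_zero_of_powerTestZero hn h, fun h3 ↦ absurd h3 h2⟩

end LogForm

section GeneratingFunction

open PowerSeries PowerSeries.WithPiTopology Filter Topology

/-- The real power series `A` converges absolutely at `q`, with value `v`. -/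
def EvalsTo (A : ℝ⟦X⟧) (q v : ℂ) : Prop :=
  Summable (fun n ↦ ‖((coeff n A : ℝ) : ℂ) * q ^ n‖) ∧ ∑' n, ((coeff n A : ℝ) : ℂ) * q ^ n = v

theorem EvalsTo.mul {A B : ℝ⟦X⟧} {q v w : ℂ} (hA : EvalsTo A q v) (hB : EvalsTo B q w) :
    EvalsTo (A * B) q (v * w) := by
  have key : ∀ n, ((coeff n (A * B) : ℝ) : ℂ) * q ^ n = ∑ kl ∈ Finset.HasAntidiagonal.antidiagonal n,
      (((coeff kl.1 A : ℝ) : ℂ) * q ^ kl.1) * (((coeff kl.2 B : ℝ) : ℂ) * q ^ kl.2) := by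
    intro n
    rw [coeff_mul, Complex.ofReal_sum, Finset.sum_mul]
    refine Finset.sum_congr rfl fun kl hkl ↦ ?_
    rw [← Finset.HasAntidiagonal.mem_antidiagonal.1 hkl, pow_add]
    push_cast
    ring
  constructor
  · simp_rw [key]
    exact summable_norm_sum_mul_antidiagonal_of_summable_norm (R := ℂ)
      (f := fun n ↦ ((coeff n A : ℝ) : ℂ) * q ^ n) (g := fun n ↦ ((coeff n B : ℝ) : ℂ) * q ^ n)
      hA.1 hB.1
  · rw [tsum_congr key]
    have h := tsum_mul_tsum_eq_tsum_sum_antidiagonal_of_summable_norm (R := ℂ)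
      (f := fun n ↦ ((coeff n A : ℝ) : ℂ) * q ^ n) (g := fun n ↦ ((coeff n B : ℝ) : ℂ) * q ^ n)
      hA.1 hB.1
    rw [hA.2, hB.2] at h
    exact h.symm

theorem EvalsTo.of_polynomial (p : Polynomial ℝ) (q : ℂ) :
    EvalsTo (p : ℝ⟦X⟧) q (p.eval₂ (algebraMap ℝ ℂ) q) := by
  have h0 : ∀ n ∉ p.support, ((coeff n (p : ℝ⟦X⟧) : ℝ) : ℂ) * q ^ n = 0 := by
    intro n hn
    simp [Polynomial.notMem_support_iff.1 hn]
  constructor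
  · refine summable_of_ne_finset_zero (s := p.support) fun n hn ↦ ?_
    rw [h0 n hn, norm_zero]
  · rw [tsum_eq_sum h0, Polynomial.eval₂_eq_sum, Polynomial.sum]
    simp

/-- The generating function of overpartitions into parts equal to `i + 1`. -/
noncomputable def overFactor (i : ℕ) : ℝ⟦X⟧ :=
  (1 + X ^ (i + 1)) * expand (i + 1) i.succ_ne_zero (mk 1)

theorem expand_mk_one_mul (i : ℕ) :
    expand (i + 1) i.succ_ne_zero (mk 1 : ℝ⟦X⟧) * (1 - X ^ (i + 1)) = 1 := by
  have h := congrArg (expand (i + 1) i.succ_ne_zero) (mk_one_mul_one_sub_eq_one ℝ)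
  simpa [expand_X] using h

theorem hasProd_overFactor :
    HasProd overFactor (PowerSeries.mk fun n ↦ (pbar n : ℝ)) := by
  convert hasProd_pbar ℝ using 2 with i
  rw [overFactor]
  congr 1
  have h1 := expand_mk_one_mul i
  have h2 := tsum_X_pow_mul_one_sub ℝ i
  rw [mul_comm] at h2
  exact left_inv_eq_right_inv h1 h2

theorem coeff_expand_mk_one_nonneg (i n : ℕ) :
    0 ≤ coeff n (expand (i + 1) i.succ_ne_zero (mk 1 : ℝ⟦X⟧)) := by
  rw [coeff_expand]
  split_ifs <;> simp

theorem coeff_overFactor_nonneg (i n : ℕ) : 0 ≤ coeff n (overFactor i) := by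
  rw [overFactor, add_mul, one_mul, map_add, coeff_X_pow_mul']
  refine add_nonneg (coeff_expand_mk_one_nonneg i n) ?_
  split_ifs
  · exact coeff_expand_mk_one_nonneg i _
  · rfl

theorem coeff_zero_overFactor (i : ℕ) : coeff 0 (overFactor i) = 1 := by
  simp [overFactor, constantCoeff_expand]

theorem overFactor_evalsTo (i : ℕ) {q : ℂ} (hq : ‖q‖ < 1) :
    EvalsTo (overFactor i) q ((1 + q ^ (i + 1)) / (1 - q ^ (i + 1))) := by
  have h1 : EvalsTo (1 + X ^ (i + 1)) q (1 + q ^ (i + 1)) := by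
    have h := EvalsTo.of_polynomial (1 + Polynomial.X ^ (i + 1)) q
    rwa [Polynomial.coe_add, Polynomial.coe_pow, Polynomial.coe_one, Polynomial.coe_X,
      Polynomial.eval₂_add, Polynomial.eval₂_pow, Polynomial.eval₂_one, Polynomial.eval₂_X] at h
  have h2 : EvalsTo (1 - X ^ (i + 1)) q (1 - q ^ (i + 1)) := by
    have h := EvalsTo.of_polynomial (1 - Polynomial.X ^ (i + 1)) q
    rwa [Polynomial.coe_sub, Polynomial.coe_pow, Polynomial.coe_one, Polynomial.coe_X,
      Polynomial.eval₂_sub, Polynomial.eval₂_pow, Polynomial.eval₂_one, Polynomial.eval₂_X] at h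
  set G := expand (i + 1) i.succ_ne_zero (mk 1 : ℝ⟦X⟧) with hG
  obtain ⟨v, hv⟩ : ∃ v, EvalsTo G q v := by
    refine ⟨_, Summable.of_nonneg_of_le (fun _ ↦ norm_nonneg _) (fun n ↦ ?_)
      (summable_geometric_of_lt_one (norm_nonneg q) hq), rfl⟩
    rw [norm_mul, norm_pow, Complex.norm_real]
    refine mul_le_of_le_one_left (by positivity) ?_
    rw [hG, coeff_expand]
    split_ifs <;> simp
  have h3 := (hv.mul h2).2
  have h4 : EvalsTo (1 : ℝ⟦X⟧) q 1 := by simpa using EvalsTo.of_polynomial 1 q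
  rw [hG, expand_mk_one_mul, h4.2] at h3
  have hne : 1 - q ^ (i + 1) ≠ 0 := fun h ↦ by simp [h] at h3
  rw [div_eq_mul_inv, ← eq_inv_of_mul_eq_one_left h3.symm]
  exact h1.mul hv

/-- The partial products of the overpartition generating function. -/
noncomputable def overProd (N : ℕ) : ℝ⟦X⟧ := ∏ i ∈ Finset.range N, overFactor i

theorem coeff_overProd_nonneg (N n : ℕ) : 0 ≤ coeff n (overProd N) := by
  induction N generalizing n with
  | zero =>
    rw [overProd, Finset.prod_range_zero, coeff_one]
    split_ifs <;> simp
  | succ N ih =>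
    rw [overProd, Finset.prod_range_succ, ← overProd, coeff_mul]
    exact Finset.sum_nonneg fun kl _ ↦ mul_nonneg (ih _) (coeff_overFactor_nonneg _ _)

theorem coeff_overProd_mono (n : ℕ) : Monotone fun N ↦ coeff n (overProd N) := by
  refine monotone_nat_of_le_succ fun N ↦ ?_
  conv_rhs => rw [overProd, Finset.prod_range_succ, ← overProd, coeff_mul]
  refine le_trans (le_of_eq ?_) (Finset.single_le_sum
    (f := fun kl : ℕ × ℕ ↦ coeff kl.1 (overProd N) * coeff kl.2 (overFactor N))
    (fun kl _ ↦ mul_nonneg (coeff_overProd_nonneg _ _) (coeff_overFactor_nonneg _ _))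
    (Finset.HasAntidiagonal.mem_antidiagonal (a := (n, 0)) |>.2 (add_zero n)))
  simp [coeff_zero_overFactor]

theorem tendsto_coeff_overProd (n : ℕ) :
    Tendsto (fun N ↦ coeff n (overProd N)) atTop (𝓝 (pbar n : ℝ)) := by
  have h := (tendsto_iff_coeff_tendsto ℝ _ _ _).1 hasProd_overFactor.tendsto_prod_nat n
  rwa [coeff_mk] at h

theorem coeff_overProd_le (N n : ℕ) : coeff n (overProd N) ≤ pbar n :=
  (coeff_overProd_mono n).ge_of_tendsto (tendsto_coeff_overProd n) N

/-- Weights in the expansion of the logarithm of the overpartition generating function. -/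
noncomputable def oddWeight (i : ℕ × ℕ) : ℝ := 2 / (2 * i.2 + 1)

/-- Exponents in the expansion of the logarithm of the overpartition generating function. -/
def oddFreq (i : ℕ × ℕ) : ℕ := (i.1 + 1) * (2 * i.2 + 1)

theorem oddWeight_pos (i : ℕ × ℕ) : 0 < oddWeight i := by
  rw [oddWeight]
  positivity

theorem summable_pow_oddFreq {r : ℝ} (h0 : 0 ≤ r) (h1 : r < 1) :
    Summable fun i ↦ r ^ oddFreq i := by
  have hg := summable_geometric_of_lt_one h0 h1
  refine Summable.of_nonneg_of_le (fun _ ↦ pow_nonneg h0 _) (fun i ↦ ?_)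
    (hg.mul_of_nonneg hg (fun _ ↦ pow_nonneg h0 _) fun _ ↦ pow_nonneg h0 _)
  rw [← pow_add]
  refine pow_le_pow_of_le_one h0 h1.le ?_
  rw [oddFreq]
  nlinarith [Nat.zero_le (i.1 * i.2)]

theorem oddWeight_le (i : ℕ × ℕ) : oddWeight i ≤ 2 := by
  rw [oddWeight]
  exact div_le_self zero_le_two (by linarith [(Nat.cast_nonneg i.2 : (0 : ℝ) ≤ _)])

theorem summable_oddWeight_mul_pow {q : ℂ} (hq : ‖q‖ < 1) :
    Summable fun i ↦ (oddWeight i : ℂ) * q ^ oddFreq i := by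
  refine Summable.of_norm_bounded ((summable_pow_oddFreq (norm_nonneg q) hq).mul_left 2)
    fun i ↦ ?_
  rw [norm_mul, norm_pow, Complex.norm_real, norm_of_nonneg (oddWeight_pos i).le]
  gcongr
  exact oddWeight_le i

theorem hasSum_oddWeight_exp {z : ℂ} (hz : ‖z‖ < 1) :
    ∃ s, HasSum (fun m : ℕ ↦ (2 / (2 * m + 1) : ℂ) * z ^ (2 * m + 1)) s ∧
      Complex.exp s = (1 + z) / (1 - z) := by
  refine ⟨Complex.log (1 + z) - Complex.log (1 - z), ?_, ?_⟩
  · have h1 := (Complex.hasSum_taylorSeries_neg_log' hz).add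
      (Complex.hasSum_taylorSeries_neg_log' (z := -z) (by rwa [norm_neg])).neg
    rw [sub_neg_eq_add, neg_neg, add_comm, ← sub_eq_add_neg] at h1
    have hinj := mul_right_injective₀ (two_ne_zero' ℕ)
    rw [← hinj.hasSum_iff] at h1
    · convert h1 using 2 with m
      simp only [Function.comp_apply]
      rw [Odd.neg_pow ⟨m, rfl⟩ z]
      push_cast
      ring
    · intro m hm
      have hm' : Even (m + 1) := by
        rw [Nat.even_add_one]
        rintro ⟨k, hk⟩
        exact hm ⟨k, by simp; omega⟩
      rw [hm'.neg_pow, add_neg_cancel]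
  · have e1 : 1 + z ≠ 0 := fun h ↦ by
      rw [← neg_eq_of_add_eq_zero_right h] at hz
      simp at hz
    have e2 : 1 - z ≠ 0 := fun h ↦ by
      rw [← sub_eq_zero.1 h] at hz
      simp at hz
    rw [Complex.exp_sub, Complex.exp_log e1, Complex.exp_log e2]

theorem overProd_evalsTo (N : ℕ) {q : ℂ} (hq : ‖q‖ < 1) :
    EvalsTo (overProd N) q
      (Complex.exp (∑ k ∈ Finset.range N, ∑' m, (oddWeight (k, m) : ℂ) * q ^ oddFreq (k, m))) := by
  induction N with
  | zero => simpa [overProd] using EvalsTo.of_polynomial 1 q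
  | succ N ih =>
    rw [overProd, Finset.prod_range_succ, ← overProd, Finset.sum_range_succ, Complex.exp_add]
    convert ih.mul (overFactor_evalsTo N hq) using 2
    obtain ⟨s, h1, h2⟩ := hasSum_oddWeight_exp (z := q ^ (N + 1))
      (by rw [norm_pow]; exact pow_lt_one₀ (norm_nonneg q) hq N.succ_ne_zero)
    rw [← h2, ← h1.tsum_eq]
    simp only [oddWeight, oddFreq, pow_mul]
    push_cast
    rfl

theorem tendsto_exp_sum_oddWeight {q : ℂ} (hq : ‖q‖ < 1) :
    Tendsto (fun N ↦ Complex.exp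
      (∑ k ∈ Finset.range N, ∑' m, (oddWeight (k, m) : ℂ) * q ^ oddFreq (k, m))) atTop
      (𝓝 (Complex.exp (∑' i, (oddWeight i : ℂ) * q ^ oddFreq i))) := by
  have h := summable_oddWeight_mul_pow hq
  exact (Complex.continuous_exp.tendsto _).comp
    ((h.hasSum.prod_fiberwise fun k ↦ (h.prod_factor k).hasSum).tendsto_sum_nat)

theorem summable_pbar_mul_pow {r : ℝ} (h0 : 0 ≤ r) (h1 : r < 1) :
    Summable fun n ↦ (pbar n : ℝ) * r ^ n := by
  have hr : ‖(r : ℂ)‖ < 1 := by rwa [Complex.norm_real, norm_of_nonneg h0]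
  have hval : ∀ N, HasSum (fun n ↦ coeff n (overProd N) * r ^ n) (∑' n, coeff n (overProd N) * r ^ n) := by
    intro N
    refine Summable.hasSum ?_
    have := (overProd_evalsTo N hr).1
    simpa [abs_of_nonneg, h0, coeff_overProd_nonneg] using this
  have hlim : Tendsto (fun N ↦ ‖((∑' n, coeff n (overProd N) * r ^ n : ℝ) : ℂ)‖) atTop
      (𝓝 ‖Complex.exp (∑' i, (oddWeight i : ℂ) * (r : ℂ) ^ oddFreq i)‖) := by
    refine ((tendsto_exp_sum_oddWeight hr).congr fun N ↦ ?_).norm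
    rw [← (overProd_evalsTo N hr).2]
    push_cast
    rfl
  refine summable_of_sum_le (c := ‖Complex.exp (∑' i, (oddWeight i : ℂ) * (r : ℂ) ^ oddFreq i)‖)
    (fun n ↦ by positivity) fun u ↦ ?_
  refine le_of_tendsto_of_tendsto
    (tendsto_finsetSum u fun n _ ↦ (tendsto_coeff_overProd n).mul_const (r ^ n)) hlim
    (Eventually.of_forall fun N ↦ ?_)
  refine (sum_le_hasSum u (fun n _ ↦ mul_nonneg (coeff_overProd_nonneg N n)
    (pow_nonneg h0 n)) (hval N)).trans ?_
  simp only [Complex.norm_real]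
  exact le_abs_self _

theorem hasSum_pbar {q : ℂ} (hq : ‖q‖ < 1) :
    HasSum (fun n ↦ (pbar n : ℂ) * q ^ n)
      (Complex.exp (∑' i, (oddWeight i : ℂ) * q ^ oddFreq i)) := by
  have hs := summable_pbar_mul_pow (norm_nonneg q) hq
  have hs' : Summable fun n ↦ (pbar n : ℂ) * q ^ n :=
    Summable.of_norm_bounded hs fun n ↦ by simp
  have hlim : Tendsto (fun N ↦ ∑' n, ((coeff n (overProd N) : ℝ) : ℂ) * q ^ n) atTop
      (𝓝 (∑' n, (pbar n : ℂ) * q ^ n)) := by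
    refine tendsto_tsum_of_dominated_convergence hs (fun n ↦ ?_)
      (Eventually.of_forall fun N n ↦ ?_)
    · have := (Complex.continuous_ofReal.tendsto _).comp (tendsto_coeff_overProd n)
      simpa using this.mul_const (q ^ n)
    · rw [norm_mul, norm_pow, Complex.norm_real, norm_of_nonneg (coeff_overProd_nonneg N n)]
      gcongr
      exact coeff_overProd_le N n
  rw [← tendsto_nhds_unique hlim
    ((tendsto_exp_sum_oddWeight hq).congr fun N ↦ (overProd_evalsTo N hq).2.symm)]
  exact hs'.hasSum

end GeneratingFunction

section Cumulants

open Filter Topology Finset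

theorem cast_choose_three (n : ℕ) :
    ((n + 3).choose 3 : ℝ) = (n + 3) * (n + 2) * (n + 1) / 6 := by
  induction n with
  | zero => norm_num
  | succ n ih =>
    rw [show n + 1 + 3 = (n + 3) + 1 by ring, Nat.choose_succ_succ, Nat.cast_add, ih,
      Nat.cast_choose_two]
    push_cast
    ring

theorem hasSum_succ_pow_one {z : ℝ} (hz : ‖z‖ < 1) :
    HasSum (fun k : ℕ ↦ ((k : ℝ) + 1) ^ 1 * z ^ (k + 1)) (z / (1 - z) ^ 2) := by
  convert! (hasSum_choose_mul_geometric_of_norm_lt_one 1 hz).mul_left z using 1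
  · ext k
    simp only [Nat.choose_one_right]
    push_cast
    ring
  · ring

theorem hasSum_succ_pow_two {z : ℝ} (hz : ‖z‖ < 1) :
    HasSum (fun k : ℕ ↦ ((k : ℝ) + 1) ^ 2 * z ^ (k + 1)) (z * (1 + z) / (1 - z) ^ 3) := by
  have hne : 1 - z ≠ 0 := by
    have := (abs_lt.1 hz).2
    linarith
  convert! ((hasSum_choose_mul_geometric_of_norm_lt_one 2 hz).mul_left (2 * z)).sub
    (hasSum_succ_pow_one hz) using 1
  · ext k
    rw [Nat.cast_choose_two]
    push_cast
    ring
  · field_simp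
    ring

theorem hasSum_succ_pow_three {z : ℝ} (hz : ‖z‖ < 1) :
    HasSum (fun k : ℕ ↦ ((k : ℝ) + 1) ^ 3 * z ^ (k + 1))
      (z * (1 + 4 * z + z ^ 2) / (1 - z) ^ 4) := by
  have hne : 1 - z ≠ 0 := by
    have := (abs_lt.1 hz).2
    linarith
  convert! (((hasSum_choose_mul_geometric_of_norm_lt_one 3 hz).mul_left (6 * z)).sub
    ((hasSum_choose_mul_geometric_of_norm_lt_one 2 hz).mul_left (6 * z))).add
    (hasSum_succ_pow_one hz) using 1
  · ext k
    rw [Nat.cast_choose_two, cast_choose_three]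
    push_cast
    ring
  · field_simp
    ring

theorem exp_add_exp_neg_sub_two_ge (y : ℝ) :
    y ^ 2 + (y ^ 2) ^ 2 / 12 + (y ^ 2) ^ 3 / 360 ≤ exp y + exp (-y) - 2 := by
  have h := sum_le_hasSum (range 4) (fun n _ ↦ by
    rw [pow_mul]
    positivity) (Real.hasSum_cosh y)
  rw [cosh_eq] at h
  simp only [sum_range_succ, range_zero, sum_empty] at h
  norm_num [Nat.factorial] at h
  linarith

/-- Real numbers `z = e ^ (-y)` satisfy `z / (1 - z) ^ 2 = 1 / (e ^ y + e ^ (-y) - 2)`. -/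
theorem exp_neg_div_one_sub_sq {y : ℝ} (hy : 0 < y) :
    exp (-y) / (1 - exp (-y)) ^ 2 * (exp y + exp (-y) - 2) = 1 := by
  have h1 : 1 - exp (-y) ≠ 0 := by
    have : exp (-y) < 1 := exp_lt_one_iff.2 (by linarith)
    linarith
  have h2 : exp (-y) * exp y = 1 := by rw [← exp_add]; simp
  rw [div_mul_eq_mul_div, div_eq_one_iff_eq (pow_ne_zero 2 h1)]
  linear_combination h2

theorem tsum_succ_pow_zero_le {y : ℝ} (hy : 0 < y) :
    ∑' k : ℕ, ((k : ℝ) + 1) ^ 0 * exp (-y) ^ (k + 1) ≤ 1 / y ^ (0 + 1) := by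
  have hz : exp (-y) < 1 := exp_lt_one_iff.2 (by linarith)
  have h := (hasSum_geometric_of_lt_one (exp_nonneg (-y)) hz).mul_left (exp (-y))
  have h2 : exp (-y) * exp y = 1 := by rw [← exp_add]; simp
  have h3 := add_one_le_exp y
  simp only [pow_zero, one_mul, pow_succ' _ _]
  rw [h.tsum_eq, mul_one, ← div_eq_mul_inv, div_le_div_iff₀ (by linarith) hy]
  nlinarith [exp_pos (-y)]

theorem norm_exp_neg_lt_one {y : ℝ} (hy : 0 < y) : ‖exp (-y)‖ < 1 := by
  rw [norm_of_nonneg (exp_nonneg _)]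
  exact exp_lt_one_iff.2 (by linarith)

theorem tsum_succ_pow_one_le {y : ℝ} (hy : 0 < y) :
    ∑' k : ℕ, ((k : ℝ) + 1) ^ 1 * exp (-y) ^ (k + 1) ≤ 1 / y ^ (1 + 1) := by
  rw [(hasSum_succ_pow_one (norm_exp_neg_lt_one hy)).tsum_eq, le_div_iff₀ (by positivity)]
  refine le_of_le_of_eq ?_ (exp_neg_div_one_sub_sq hy)
  refine mul_le_mul_of_nonneg_left ?_ (by positivity)
  refine le_trans ?_ (exp_add_exp_neg_sub_two_ge y)
  have : 0 ≤ (y ^ 2) ^ 2 / 12 + (y ^ 2) ^ 3 / 360 := by positivity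
  norm_num
  linarith

theorem tsum_succ_pow_two_le {y : ℝ} (hy : 0 < y) :
    ∑' k : ℕ, ((k : ℝ) + 1) ^ 2 * exp (-y) ^ (k + 1) ≤ 2 / y ^ (2 + 1) := by
  rw [(hasSum_succ_pow_two (norm_exp_neg_lt_one hy)).tsum_eq]
  have hD := exp_neg_div_one_sub_sq hy
  have hge := exp_add_exp_neg_sub_two_ge y
  have hz : exp (-y) < 1 := exp_lt_one_iff.2 (by linarith)
  set z := exp (-y) with hzdef
  have hz0 : 0 < z := exp_pos _
  have h1z : 0 < 1 - z := by linarith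
  set v := z / (1 - z) ^ 2 with hv
  have hv0 : 0 < v := by positivity
  set D := exp y + z - 2 with hDdef
  set s := y ^ 2 with hs
  have hs0 : 0 < s := by positivity
  have hD1 : s + s ^ 2 / 12 ≤ D := by
    have : 0 ≤ s ^ 3 / 360 := by positivity
    linarith
  have hD0 : 0 < D := by nlinarith [sq_nonneg s]
  have hvD : v = 1 / D := by
    rw [eq_div_iff hD0.ne']
    exact hD
  have hsq : (z * (1 + z) / (1 - z) ^ 3) ^ 2 = (D + 4) / D ^ 3 := by
    have : (z * (1 + z) / (1 - z) ^ 3) ^ 2 = v ^ 2 * (1 + 4 * v) := by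
      rw [hv]
      field_simp
      ring
    rw [this, hvD]
    field_simp
  have hmain : (D + 4) * s ^ 3 ≤ 4 * D ^ 3 := by
    obtain ⟨u, hu⟩ : ∃ u, D = s * (1 + u) := ⟨D / s - 1, by field_simp; ring⟩
    have hu' : s / 12 ≤ u := by
      have : s * (s / 12) ≤ s * u := by nlinarith
      exact le_of_mul_le_mul_left this hs0
    have hu0 : 0 ≤ u := by linarith
    have h3 : s * (1 + u) + 4 ≤ 4 * (1 + u) ^ 3 := by nlinarith [pow_nonneg hu0 3]
    rw [hu, mul_pow]
    nlinarith [mul_le_mul_of_nonneg_right h3 (pow_nonneg hs0.le 3)]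
  refine le_of_sq_le_sq ?_ (by positivity)
  rw [hsq, div_pow, div_le_div_iff₀ (by positivity) (by positivity)]
  have : (y ^ (2 + 1)) ^ 2 = s ^ 3 := by rw [hs]; ring
  rw [this]
  linarith

theorem tsum_succ_pow_three_le {y : ℝ} (hy : 0 < y) :
    ∑' k : ℕ, ((k : ℝ) + 1) ^ 3 * exp (-y) ^ (k + 1) ≤ (20 / 3) / y ^ (3 + 1) := by
  rw [(hasSum_succ_pow_three (norm_exp_neg_lt_one hy)).tsum_eq]
  have hD := exp_neg_div_one_sub_sq hy
  have hge := exp_add_exp_neg_sub_two_ge y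
  have hz : exp (-y) < 1 := exp_lt_one_iff.2 (by linarith)
  set z := exp (-y) with hzdef
  have hz0 : 0 < z := exp_pos _
  have h1z : 0 < 1 - z := by linarith
  set v := z / (1 - z) ^ 2 with hv
  have hv0 : 0 < v := by positivity
  set D := exp y + z - 2 with hDdef
  set s := y ^ 2 with hs
  have hs0 : 0 < s := by positivity
  set E := 1 + s / 12 + s ^ 2 / 360 with hE
  have hE0 : 0 < E := by positivity
  have hvE : v * (s * E) ≤ 1 := by
    rw [← hD]
    refine mul_le_mul_of_nonneg_left ?_ hv0.le
    rw [hE]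
    linarith
  have hsplit : z * (1 + 4 * z + z ^ 2) / (1 - z) ^ 4 = 6 * v ^ 2 + v := by
    rw [hv]
    field_simp
    ring
  have hy4 : y ^ (3 + 1) = s ^ 2 := by rw [hs]; ring
  rw [hsplit, hy4, le_div_iff₀ (by positivity)]
  have hvs : v * s ≤ 1 / E := by
    rw [le_div_iff₀ hE0]
    linarith
  have hvs0 : 0 ≤ v * s := by positivity
  have h1 : (v * s) ^ 2 ≤ (1 / E) ^ 2 := pow_le_pow_left₀ hvs0 hvs 2
  have h2 : (6 * v ^ 2 + v) * s ^ 2 ≤ 6 * (1 / E) ^ 2 + s * (1 / E) := by nlinarith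
  refine h2.trans ?_
  have h3 : 6 * (1 / E) ^ 2 + s * (1 / E) = (6 + s * E) / E ^ 2 := by field_simp
  rw [h3, div_le_iff₀ (by positivity), hE]
  nlinarith [pow_pos hs0 2, pow_pos hs0 3, pow_pos hs0 4, hs0, mul_nonneg hs0.le (sq_nonneg (s - 6))]

/-- The cumulants of the weights `oddWeight i * e ^ (-oddFreq i * t)`. -/
noncomputable def oddCumulant (j : ℕ) (t : ℝ) : ℝ :=
  ∑' i, oddWeight i * (oddFreq i : ℝ) ^ j * exp (-t) ^ oddFreq i

theorem summable_oddCumulant (j : ℕ) {t : ℝ} (ht : 0 < t) :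
    Summable fun i ↦ oddWeight i * (oddFreq i : ℝ) ^ j * exp (-t) ^ oddFreq i := by
  set s := exp (-(t / 2)) with hs
  have hs1 : s < 1 := exp_lt_one_iff.2 (by linarith)
  have hs0 : 0 < s := exp_pos _
  have hs2 : exp (-t) = s * s := by
    rw [hs, ← exp_add]
    ring_nf
  obtain ⟨B, hB⟩ := (tendsto_pow_const_mul_const_pow_of_lt_one j hs0.le hs1).bddAbove_range
  refine Summable.of_nonneg_of_le (fun i ↦ ?_) (fun i ↦ ?_)
    ((summable_pow_oddFreq hs0.le hs1).mul_left (2 * B))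
  · have := (oddWeight_pos i).le
    positivity
  · have h1 : (oddFreq i : ℝ) ^ j * s ^ oddFreq i ≤ B := hB ⟨oddFreq i, rfl⟩
    have h2 := oddWeight_le i
    have h3 := (oddWeight_pos i).le
    have h4 : 0 ≤ (oddFreq i : ℝ) ^ j * s ^ oddFreq i := by positivity
    calc oddWeight i * (oddFreq i : ℝ) ^ j * exp (-t) ^ oddFreq i
        = oddWeight i * ((oddFreq i : ℝ) ^ j * s ^ oddFreq i) * s ^ oddFreq i := by
          rw [hs2, mul_pow]
          ring
      _ ≤ 2 * B * s ^ oddFreq i := by gcongr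

theorem oddCumulant_eq (j : ℕ) {t : ℝ} (ht : 0 < t) :
    oddCumulant j t = ∑' m : ℕ, 2 / (2 * m + 1) * (2 * m + 1 : ℝ) ^ j *
      ∑' k : ℕ, ((k : ℝ) + 1) ^ j * exp (-((2 * m + 1) * t)) ^ (k + 1) := by
  have h := summable_oddCumulant j ht
  rw [oddCumulant, h.tsum_prod, ← Summable.tsum_comm (f := fun k m ↦
    oddWeight (k, m) * (oddFreq (k, m) : ℝ) ^ j * exp (-t) ^ oddFreq (k, m)) h]
  refine tsum_congr fun m ↦ ?_
  rw [← tsum_mul_left]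
  refine tsum_congr fun k ↦ ?_
  have : exp (-((2 * m + 1) * t)) = exp (-t) ^ (2 * m + 1) := by
    rw [← exp_nat_mul]
    push_cast
    ring_nf
  rw [this, ← pow_mul, oddWeight, oddFreq, mul_comm (2 * m + 1) (k + 1)]
  push_cast
  rw [mul_pow]
  ring

theorem summable_oddCumulant_outer (j : ℕ) {t : ℝ} (ht : 0 < t) :
    Summable fun m : ℕ ↦ 2 / (2 * m + 1) * (2 * m + 1 : ℝ) ^ j *
      ∑' k : ℕ, ((k : ℝ) + 1) ^ j * exp (-((2 * m + 1) * t)) ^ (k + 1) := by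
  have h := ((summable_oddCumulant j ht).comp_injective
    (Equiv.prodComm ℕ ℕ).injective).prod
  refine h.congr fun m ↦ ?_
  rw [← tsum_mul_left]
  refine tsum_congr fun k ↦ ?_
  have : exp (-((2 * m + 1) * t)) = exp (-t) ^ (2 * m + 1) := by
    rw [← exp_nat_mul]
    push_cast
    ring_nf
  simp only [Function.comp_apply, Equiv.prodComm_apply, Prod.swap_prod_mk]
  rw [this, ← pow_mul, oddWeight, oddFreq, mul_comm (2 * m + 1) (k + 1)]
  push_cast
  rw [mul_pow]
  ring

theorem hasSum_inv_odd_sq : HasSum (fun m : ℕ ↦ 1 / (2 * m + 1 : ℝ) ^ 2) (π ^ 2 / 8) := by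
  have h := hasSum_zeta_two
  have he : HasSum (fun m : ℕ ↦ 1 / ((2 * m : ℕ) : ℝ) ^ 2) (π ^ 2 / 24) := by
    have hf : (fun m : ℕ ↦ 1 / ((2 * m : ℕ) : ℝ) ^ 2) = fun m : ℕ ↦ 1 / 4 * (1 / (m : ℝ) ^ 2) := by
      ext m
      push_cast
      rw [mul_pow, one_div_mul_one_div]
      norm_num
    rw [hf, show π ^ 2 / 24 = 1 / 4 * (π ^ 2 / 6) by ring]
    exact h.mul_left _
  have ho : Summable fun m : ℕ ↦ 1 / ((2 * m + 1 : ℕ) : ℝ) ^ 2 :=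
    h.summable.comp_injective (i := fun m : ℕ ↦ 2 * m + 1) fun a b hab ↦ by
      simp only at hab
      omega
  have hu := (HasSum.even_add_odd (f := fun n : ℕ ↦ 1 / (n : ℝ) ^ 2) he ho.hasSum).unique h
  have h8 : ∑' m : ℕ, 1 / ((2 * m + 1 : ℕ) : ℝ) ^ 2 = π ^ 2 / 8 := by linarith
  have hf : (fun m : ℕ ↦ 1 / (2 * m + 1 : ℝ) ^ 2) = fun m : ℕ ↦ 1 / ((2 * m + 1 : ℕ) : ℝ) ^ 2 := by
    ext m
    push_cast
    rfl
  rw [hf, ← h8]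
  exact ho.hasSum

theorem oddCumulant_le {j : ℕ} {C t : ℝ} (ht : 0 < t)
    (h : ∀ y : ℝ, 0 < y → ∑' k : ℕ, ((k : ℝ) + 1) ^ j * exp (-y) ^ (k + 1) ≤ C / y ^ (j + 1)) :
    oddCumulant j t ≤ C * (π ^ 2 / 4) / t ^ (j + 1) := by
  have hs := hasSum_inv_odd_sq.mul_left (2 * C / t ^ (j + 1))
  rw [oddCumulant_eq j ht]
  refine ((summable_oddCumulant_outer j ht).tsum_le_tsum (fun m ↦ ?_) hs.summable).trans ?_
  · have hM : (0 : ℝ) < 2 * m + 1 := by positivity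
    refine (mul_le_mul_of_nonneg_left (h ((2 * m + 1) * t) (by positivity))
      (by positivity)).trans_eq ?_
    rw [mul_pow, pow_succ (2 * m + 1 : ℝ) j]
    field_simp
  · rw [hs.tsum_eq]
    apply le_of_eq
    ring

theorem one_div_exp_sub_one_ge {y : ℝ} (hy : 0 < y) : 1 / y - 1 / 2 ≤ 1 / (exp y - 1) := by
  have he := add_one_lt_exp hy.ne'
  have he0 : 0 < exp y - 1 := by linarith
  rcases le_or_gt 2 y with h2 | h2
  · have : 1 / y ≤ 1 / 2 := one_div_le_one_div_of_le two_pos h2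
    have : 0 < 1 / (exp y - 1) := by positivity
    linarith
  · have hx : |y / 2| < 1 := by rw [abs_lt]; constructor <;> linarith
    have h := sum_le_hasSum (range 1) (fun k _ ↦ by positivity)
      (hasSum_log_sub_log_of_abs_lt_one hx)
    simp only [range_one, sum_singleton] at h
    norm_num at h
    have h3 : exp y ≤ (1 + y / 2) / (1 - y / 2) := by
      rw [← log_div (by linarith) (by linarith)] at h
      have := exp_le_exp.2 h
      rw [exp_log (div_pos (by linarith) (by linarith))] at this
      convert this using 2
      ring
    have h4 : 0 < 1 - y / 2 := by linarith
    rw [le_div_iff₀ h4] at h3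
    rw [div_sub_div _ _ hy.ne' two_ne_zero, div_le_div_iff₀ (by positivity) he0]
    nlinarith

theorem oddCumulant_zero_ge {t : ℝ} (ht : 0 < t) :
    2.367 / t - 1.788 ≤ oddCumulant 0 t := by
  rw [oddCumulant_eq 0 ht]
  refine le_trans ?_ ((summable_oddCumulant_outer 0 ht).sum_le_tsum (range 5) fun m _ ↦
    mul_nonneg (by positivity) (tsum_nonneg fun k ↦ by positivity))
  have hin : ∀ m : ℕ, 1 / ((2 * m + 1) * t) - 1 / 2 ≤
      ∑' k : ℕ, ((k : ℝ) + 1) ^ 0 * exp (-((2 * m + 1) * t)) ^ (k + 1) := by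
    intro m
    have hy : 0 < (2 * m + 1) * t := by positivity
    refine (one_div_exp_sub_one_ge hy).trans_eq ?_
    have hz : exp (-((2 * m + 1) * t)) < 1 := exp_lt_one_iff.2 (by linarith)
    simp only [pow_zero, one_mul, pow_succ']
    rw [((hasSum_geometric_of_lt_one (exp_nonneg _) hz).mul_left _).tsum_eq, exp_neg]
    have : 1 < exp ((2 * m + 1) * t) := one_lt_exp_iff.2 hy
    have : exp ((2 * m + 1) * t) - 1 ≠ 0 := by linarith
    field_simp
  have hle : ∑ m ∈ range 5, 2 / (2 * m + 1) * (2 * m + 1 : ℝ) ^ 0 *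
      (1 / ((2 * m + 1) * t) - 1 / 2) ≤ _ :=
    sum_le_sum fun m _ ↦ mul_le_mul_of_nonneg_left (hin m) (by positivity)
  refine le_trans ?_ hle
  simp only [sum_range_succ, range_zero, sum_empty]
  norm_num
  have : 0 < t⁻¹ := by positivity
  rw [div_eq_mul_inv]
  linarith

theorem continuousOn_oddCumulant (j : ℕ) : ContinuousOn (oddCumulant j) (Set.Ioi 0) := by
  intro a ha
  have ha0 : 0 < a := ha
  refine ContinuousAt.continuousWithinAt (ContinuousOn.continuousAt (s := Set.Ici (a / 2)) ?_
    (Ici_mem_nhds (by linarith)))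
  refine continuousOn_tsum (fun i ↦ by fun_prop) (summable_oddCumulant j (half_pos ha0))
    fun i t ht ↦ ?_
  have := (oddWeight_pos i).le
  rw [norm_of_nonneg (by positivity)]
  gcongr
  exact ht

theorem exists_oddCumulant_one_eq {n : ℕ} (hn : 2 ≤ n) :
    ∃ t, 0 < t ∧ oddCumulant 1 t = n := by
  have hn2 : (2 : ℝ) ≤ n := by exact_mod_cast hn
  have hlow : (n : ℝ) ≤ oddCumulant 1 (1 / n) := by
    have hsub := (summable_oddCumulant 1 (t := 1 / n) (by positivity)).sum_le_tsum
      ((range n).image fun k ↦ (k, 0)) fun i _ ↦ by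
        have := (oddWeight_pos i).le
        positivity
    refine le_trans ?_ hsub
    rw [sum_image (fun a _ b _ h ↦ by simpa using h)]
    have hterm : ∀ k ∈ range n, 2 / exp 1 * (k + 1 : ℝ) ≤ oddWeight (k, 0) *
        (oddFreq (k, 0) : ℝ) ^ 1 * exp (-(1 / n)) ^ oddFreq (k, 0) := by
      intro k hk
      have hk' : (k + 1 : ℝ) ≤ n := by exact_mod_cast mem_range.1 hk
      have h1 : exp (-1) ≤ exp (-(1 / n)) ^ (k + 1) := by
        rw [← exp_nat_mul, exp_le_exp]
        push_cast
        rw [mul_neg, neg_le_neg_iff, mul_one_div, div_le_one (by linarith)]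
        exact hk'
      simp only [oddWeight, oddFreq, CharP.cast_eq_zero, mul_zero, zero_add, mul_one, div_one,
        pow_one, Nat.cast_add, Nat.cast_one]
      rw [div_eq_mul_inv, ← exp_neg]
      nlinarith [mul_le_mul_of_nonneg_left h1 (by positivity : (0 : ℝ) ≤ 2 * (k + 1))]
    refine le_trans ?_ (sum_le_sum hterm)
    have hsum : ∑ k ∈ range n, (k + 1 : ℝ) = n * (n + 1) / 2 := by
      clear * -
      induction n with
      | zero => simp
      | succ n ih =>
        rw [sum_range_succ, ih]
        push_cast
        ring
    rw [← mul_sum, hsum, div_mul_eq_mul_div, le_div_iff₀ (exp_pos 1)]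
    nlinarith [exp_one_lt_d9]
  have hup : oddCumulant 1 2 ≤ n := by
    have h := oddCumulant_le (t := 2) two_pos fun y hy ↦ tsum_succ_pow_one_le hy
    have := pi_lt_d2
    have := pi_pos
    nlinarith
  have hle : (1 / n : ℝ) ≤ 2 := by
    rw [div_le_iff₀ (by linarith)]
    linarith
  have hpos : (0 : ℝ) < 1 / n := by positivity
  obtain ⟨t, ht, h⟩ := intermediate_value_Icc' hle
    ((continuousOn_oddCumulant 1).mono fun x hx ↦ hpos.trans_le hx.1) ⟨hup, hlow⟩
  exact ⟨t, hpos.trans_le ht.1, h⟩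

end Cumulants

section Fourier

open Filter Topology MeasureTheory intervalIntegral

theorem summable_oddWeight_mul_exp {t : ℝ} (ht : 0 < t) :
    Summable fun i ↦ oddWeight i * exp (-t) ^ oddFreq i := by
  simpa using summable_oddCumulant 0 ht

theorem oddWeight_mul_exp_nonneg (t : ℝ) (i : ℕ × ℕ) :
    0 ≤ oddWeight i * exp (-t) ^ oddFreq i := by
  have := (oddWeight_pos i).le
  positivity

/-- The logarithm of the modulus of the generating function at `e ^ (-t + θ i)`, relative to its
value at `e ^ (-t)`. -/
noncomputable def saddleRe (t θ : ℝ) : ℝ :=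
  ∑' i, oddWeight i * exp (-t) ^ oddFreq i * (cos (oddFreq i * θ) - 1)

/-- The argument of the generating function at `e ^ (-t + θ i)`. -/
noncomputable def saddleIm (t θ : ℝ) : ℝ :=
  ∑' i, oddWeight i * exp (-t) ^ oddFreq i * sin (oddFreq i * θ)

theorem abs_cos_sub_one_le (x : ℝ) : |cos x - 1| ≤ 2 := by
  rw [abs_le]
  constructor <;> linarith [neg_one_le_cos x, cos_le_one x]

theorem norm_saddleRe_term_le (t θ : ℝ) (i : ℕ × ℕ) :
    ‖oddWeight i * exp (-t) ^ oddFreq i * (cos (oddFreq i * θ) - 1)‖ ≤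
      oddWeight i * exp (-t) ^ oddFreq i * 2 := by
  rw [norm_mul, norm_of_nonneg (oddWeight_mul_exp_nonneg t i)]
  exact mul_le_mul_of_nonneg_left (abs_cos_sub_one_le _) (oddWeight_mul_exp_nonneg t i)

theorem norm_saddleIm_term_le (t θ : ℝ) (i : ℕ × ℕ) :
    ‖oddWeight i * exp (-t) ^ oddFreq i * sin (oddFreq i * θ)‖ ≤
      oddWeight i * exp (-t) ^ oddFreq i := by
  rw [norm_mul, norm_of_nonneg (oddWeight_mul_exp_nonneg t i)]
  exact mul_le_of_le_one_right (oddWeight_mul_exp_nonneg t i) (abs_sin_le_one _)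

theorem summable_saddleRe {t : ℝ} (ht : 0 < t) (θ : ℝ) :
    Summable fun i ↦ oddWeight i * exp (-t) ^ oddFreq i * (cos (oddFreq i * θ) - 1) :=
  Summable.of_norm_bounded ((summable_oddWeight_mul_exp ht).mul_right 2)
    (norm_saddleRe_term_le t θ)

theorem summable_saddleIm {t : ℝ} (ht : 0 < t) (θ : ℝ) :
    Summable fun i ↦ oddWeight i * exp (-t) ^ oddFreq i * sin (oddFreq i * θ) :=
  Summable.of_norm_bounded (summable_oddWeight_mul_exp ht) (norm_saddleIm_term_le t θ)

theorem continuous_saddleRe {t : ℝ} (ht : 0 < t) : Continuous (saddleRe t) :=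
  continuous_tsum (fun i ↦ by fun_prop) ((summable_oddWeight_mul_exp ht).mul_right 2)
    fun i θ ↦ norm_saddleRe_term_le t θ i

theorem continuous_saddleIm {t : ℝ} (ht : 0 < t) : Continuous (saddleIm t) :=
  continuous_tsum (fun i ↦ by fun_prop) (summable_oddWeight_mul_exp ht)
    fun i θ ↦ norm_saddleIm_term_le t θ i

theorem pow_exp_neg_mul_cexp (t θ : ℝ) (m : ℕ) :
    ((exp (-t) : ℝ) * Complex.exp (θ * Complex.I)) ^ m =
      ((exp (-t) ^ m : ℝ) : ℂ) * Complex.exp ((m * θ : ℝ) * Complex.I) := by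
  rw [mul_pow, ← Complex.exp_nat_mul]
  push_cast
  ring_nf

theorem tsum_oddWeight_re_im {t : ℝ} (ht : 0 < t) (θ : ℝ) :
    ∑' i, (oddWeight i : ℂ) * ((exp (-t) : ℝ) * Complex.exp (θ * Complex.I)) ^ oddFreq i =
      ((oddCumulant 0 t + saddleRe t θ : ℝ) : ℂ) + (saddleIm t θ : ℝ) * Complex.I := by
  have hq : ‖((exp (-t) : ℝ) : ℂ) * Complex.exp (θ * Complex.I)‖ < 1 := by
    rw [norm_mul, Complex.norm_exp_ofReal_mul_I, mul_one, Complex.norm_real]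
    exact norm_exp_neg_lt_one ht
  have hs := (summable_oddWeight_mul_pow hq).hasSum
  have hterm : ∀ i, (oddWeight i : ℂ) *
      ((exp (-t) : ℝ) * Complex.exp (θ * Complex.I)) ^ oddFreq i =
      ((oddWeight i * exp (-t) ^ oddFreq i * cos (oddFreq i * θ) : ℝ) : ℂ) +
        ((oddWeight i * exp (-t) ^ oddFreq i * sin (oddFreq i * θ) : ℝ) : ℂ) * Complex.I := by
    intro i
    rw [pow_exp_neg_mul_cexp, Complex.exp_mul_I, ← Complex.ofReal_cos, ← Complex.ofReal_sin]
    push_cast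
    ring
  simp_rw [hterm] at hs ⊢
  have h0 : HasSum (fun i ↦ oddWeight i * exp (-t) ^ oddFreq i) (oddCumulant 0 t) := by
    have h := (summable_oddCumulant 0 ht).hasSum
    simp only [pow_zero, mul_one] at h
    rw [oddCumulant]
    simpa using h
  have hre : HasSum (fun i ↦ oddWeight i * exp (-t) ^ oddFreq i * cos (oddFreq i * θ))
      (oddCumulant 0 t + saddleRe t θ) :=
    (h0.add (summable_saddleRe ht θ).hasSum).congr_fun fun i ↦ by ring
  exact ((Complex.hasSum_ofReal.2 hre).add
    ((Complex.hasSum_ofReal.2 (summable_saddleIm ht θ).hasSum).mul_right Complex.I)).tsum_eq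

theorem hasSum_pbar_mul_cos {t : ℝ} (ht : 0 < t) (θ k : ℝ) :
    HasSum (fun m : ℕ ↦ (pbar m : ℝ) * exp (-t) ^ m * cos ((m - k) * θ))
      (exp (oddCumulant 0 t) * (exp (saddleRe t θ) * cos (saddleIm t θ - k * θ))) := by
  have hq : ‖((exp (-t) : ℝ) : ℂ) * Complex.exp (θ * Complex.I)‖ < 1 := by
    rw [norm_mul, Complex.norm_exp_ofReal_mul_I, mul_one, Complex.norm_real]
    exact norm_exp_neg_lt_one ht
  have h := Complex.hasSum_re ((hasSum_pbar hq).mul_right (Complex.exp ((-(k * θ) : ℝ) * Complex.I)))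
  rw [tsum_oddWeight_re_im ht, ← Complex.exp_add] at h
  convert! h using 1
  · ext m
    have he : Complex.exp ((m * θ : ℝ) * Complex.I) * Complex.exp ((-(k * θ) : ℝ) * Complex.I) =
        Complex.exp ((((m : ℝ) - k) * θ : ℝ) * Complex.I) := by
      rw [← Complex.exp_add]
      push_cast
      ring_nf
    rw [pow_exp_neg_mul_cexp, mul_assoc (pbar m : ℝ),
      mul_assoc (pbar m : ℂ), mul_assoc (Complex.ofReal _), he,
      ← Complex.ofReal_natCast, Complex.re_ofReal_mul, Complex.re_ofReal_mul,
      Complex.exp_ofReal_mul_I_re]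
  · rw [add_assoc, ← add_mul, ← Complex.ofReal_add, Complex.exp_re]
    simp [exp_add, sub_eq_add_neg, mul_assoc]

theorem hasSum_pbar_mul_exp {t : ℝ} (ht : 0 < t) :
    HasSum (fun m : ℕ ↦ (pbar m : ℝ) * exp (-t) ^ m) (exp (oddCumulant 0 t)) := by
  simpa [saddleRe, saddleIm] using hasSum_pbar_mul_cos ht 0 0

theorem integral_cos_sub_mul (m k : ℕ) :
    ∫ θ in -π..π, cos (((m : ℝ) - k) * θ) = if m = k then 2 * π else 0 := by
  split_ifs with h
  · subst h
    simp
    ring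
  · have hne : (m : ℝ) - k ≠ 0 := sub_ne_zero.2 (by exact_mod_cast h)
    have hs : sin (((m : ℝ) - k) * π) = 0 := by
      have := sin_int_mul_pi ((m : ℤ) - k)
      push_cast at this
      exact this
    rw [intervalIntegral.integral_comp_mul_left (fun x ↦ cos x) hne, integral_cos, mul_neg,
      sin_neg, hs]
    simp

theorem two_pi_mul_pbar {t : ℝ} (ht : 0 < t) (k : ℕ) :
    2 * π * ((pbar k : ℝ) * exp (-t) ^ k) = exp (oddCumulant 0 t) *
      ∫ θ in -π..π, exp (saddleRe t θ) * cos (saddleIm t θ - k * θ) := by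
  have hb := (hasSum_pbar_mul_exp ht).summable
  have h := intervalIntegral.hasSum_integral_of_dominated_convergence (μ := volume)
    (a := -π) (b := π)
    (F := fun (m : ℕ) (θ : ℝ) ↦ (pbar m : ℝ) * exp (-t) ^ m * cos ((m - k) * θ))
    (fun m _ ↦ (pbar m : ℝ) * exp (-t) ^ m)
    (fun m ↦ (by fun_prop : Continuous fun θ : ℝ ↦
      (pbar m : ℝ) * exp (-t) ^ m * cos ((m - k) * θ)).aestronglyMeasurable)
    (fun m ↦ Eventually.of_forall fun θ _ ↦ by
      rw [norm_mul, norm_of_nonneg (by positivity)]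
      exact mul_le_of_le_one_right (by positivity) (abs_cos_le_one _))
    (Eventually.of_forall fun θ _ ↦ hb)
    intervalIntegrable_const
    (Eventually.of_forall fun θ _ ↦ hasSum_pbar_mul_cos ht θ k)
  rw [intervalIntegral.integral_const_mul] at h
  refine HasSum.unique ?_ h
  simp_rw [intervalIntegral.integral_const_mul, integral_cos_sub_mul]
  convert! hasSum_ite_eq k (2 * π * ((pbar k : ℝ) * exp (-t) ^ k)) using 2 with m
  split_ifs with hm
  · rw [hm]
    ring
  · simp

theorem saddleRe_ge {t : ℝ} (ht : 0 < t) (θ : ℝ) :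
    -(oddCumulant 2 t * θ ^ 2 / 2) ≤ saddleRe t θ := by
  have h := ((summable_oddCumulant 2 ht).hasSum.mul_right (-(θ ^ 2 / 2)))
  refine le_trans (le_of_eq ?_) (hasSum_le (fun i ↦ ?_) h (summable_saddleRe ht θ).hasSum)
  · rw [oddCumulant]
    ring
  · have h1 := one_sub_sq_div_two_le_cos (x := oddFreq i * θ)
    have h2 := mul_le_mul_of_nonneg_left h1 (oddWeight_mul_exp_nonneg t i)
    rw [mul_pow] at h2
    linarith

theorem abs_saddleIm_sub_le {t : ℝ} (ht : 0 < t) (θ : ℝ) :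
    |saddleIm t θ - oddCumulant 1 t * θ| ≤ oddCumulant 3 t * |θ| ^ 3 / 6 := by
  have h1 := (summable_saddleIm ht θ).hasSum.sub ((summable_oddCumulant 1 ht).hasSum.mul_right θ)
  have h3 := ((summable_oddCumulant 3 ht).hasSum.mul_right (|θ| ^ 3 / 6))
  rw [mul_div_assoc]
  refine le_of_eq_of_le (congrArg norm h1.tsum_eq.symm) (tsum_of_norm_bounded h3 fun i ↦ ?_)
  · have he : oddWeight i * exp (-t) ^ oddFreq i * sin (oddFreq i * θ) -
        oddWeight i * (oddFreq i : ℝ) ^ 1 * exp (-t) ^ oddFreq i * θ =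
        -(oddWeight i * exp (-t) ^ oddFreq i * (oddFreq i * θ - sin (oddFreq i * θ))) := by ring
    rw [he, norm_neg, norm_mul, norm_of_nonneg (oddWeight_mul_exp_nonneg t i)]
    have h2 := mul_le_mul_of_nonneg_left (abs_sub_sin_le (x := oddFreq i * θ))
      (oddWeight_mul_exp_nonneg t i)
    rw [abs_mul, Nat.abs_cast, mul_pow] at h2
    rw [norm_eq_abs]
    linarith

theorem hasSum_pow_mul_one_sub_cos {z : ℝ} (hz0 : 0 ≤ z) (hz : z < 1) (θ : ℝ) :
    HasSum (fun k : ℕ ↦ 2 * z ^ (k + 1) * (1 - cos ((k + 1 : ℕ) * θ)))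
      ((1 + z) / (1 - z) * (2 * z * (1 - cos θ) / ((1 - z) ^ 2 + 2 * z * (1 - cos θ)))) := by
  have hζ : ‖(z : ℂ) * Complex.exp (θ * Complex.I)‖ < 1 := by
    rw [norm_mul, Complex.norm_exp_ofReal_mul_I, mul_one, Complex.norm_real, norm_of_nonneg hz0]
    exact hz
  have h1 := Complex.hasSum_re ((hasSum_geometric_of_norm_lt_one hζ).mul_left
    ((z : ℂ) * Complex.exp (θ * Complex.I)))
  have h2 := (hasSum_geometric_of_lt_one hz0 hz).mul_left z
  convert! (h2.sub h1).mul_left 2 using 1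
  · ext k
    rw [← pow_succ', ← pow_succ', mul_pow, ← Complex.exp_nat_mul, ← Complex.ofReal_pow,
      Complex.re_ofReal_mul, ← mul_assoc, ← Complex.ofReal_natCast, ← Complex.ofReal_mul,
      Complex.exp_ofReal_mul_I_re]
    ring
  · have hre : ((z : ℂ) * Complex.exp (θ * Complex.I)).re = z * cos θ := by
      rw [Complex.re_ofReal_mul, Complex.exp_ofReal_mul_I_re]
    have him : ((z : ℂ) * Complex.exp (θ * Complex.I)).im = z * sin θ := by
      rw [Complex.im_ofReal_mul, Complex.exp_ofReal_mul_I_im]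
    have hn : Complex.normSq (1 - (z : ℂ) * Complex.exp (θ * Complex.I)) =
        (1 - z) ^ 2 + 2 * z * (1 - cos θ) := by
      rw [Complex.normSq_apply, Complex.sub_re, Complex.sub_im, hre, him, Complex.one_re,
        Complex.one_im]
      linear_combination z ^ 2 * sin_sq_add_cos_sq θ
    have hz1 : 0 < 1 - z := by linarith
    have hQ : 0 < (1 - z) ^ 2 + 2 * z * (1 - cos θ) := by
      have : 0 ≤ 1 - cos θ := by linarith [cos_le_one θ]
      positivity
    rw [Complex.mul_re, Complex.inv_re, Complex.inv_im, Complex.sub_re, Complex.sub_im, hn, hre,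
      him, Complex.one_re, Complex.one_im]
    obtain ⟨Q, hQe⟩ : ∃ Q, Q = (1 - z) ^ 2 + 2 * z * (1 - cos θ) := ⟨_, rfl⟩
    rw [← hQe] at hQ ⊢
    have hnum : (1 + z) * (2 * z * (1 - cos θ)) = 2 * (z * Q - (1 - z) *
        (z * cos θ * (1 - z * cos θ) - z * sin θ * (z * sin θ))) := by
      linear_combination (-2 * z) * hQe - 2 * (1 - z) * z ^ 2 * sin_sq_add_cos_sq θ
    rw [div_mul_div_comm, hnum]
    field_simp
    ring

theorem saddleRe_le {t : ℝ} (ht : 0 < t) (θ : ℝ) :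
    saddleRe t θ ≤ -((1 + exp (-t)) / (1 - exp (-t)) * (2 * exp (-t) * (1 - cos θ) /
      ((1 - exp (-t)) ^ 2 + 2 * exp (-t) * (1 - cos θ)))) := by
  have hz : exp (-t) < 1 := exp_lt_one_iff.2 (by linarith)
  rw [← (hasSum_pow_mul_one_sub_cos (exp_nonneg (-t)) hz θ).tsum_eq, le_neg, saddleRe, ← tsum_neg]
  have h := tsum_comp_le_tsum_of_inj (summable_saddleRe ht θ).neg (fun i ↦ by
    have := mul_nonneg (oddWeight_mul_exp_nonneg t i) (sub_nonneg.2 (cos_le_one (oddFreq i * θ)))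
    linarith) (i := fun k : ℕ ↦ (k, 0)) fun a b hab ↦ by simpa using hab
  refine le_of_eq_of_le (tsum_congr fun k ↦ ?_) h
  simp only [Function.comp_apply, oddWeight, oddFreq, Nat.cast_zero, mul_zero, zero_add, mul_one,
    div_one]
  ring

theorem kernel_ge {t : ℝ} (ht : 0 < t) (ht1 : t ≤ 0.0201) {a C : ℝ} (ha : |a| ≤ 0.6 * t)
    (hC : 1 - cos a ≤ C) :
    1.4161 * a ^ 2 / t ^ 3 ≤ (1 + exp (-t)) / (1 - exp (-t)) * (2 * exp (-t) * C /
      ((1 - exp (-t)) ^ 2 + 2 * exp (-t) * C)) := by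
  have hz : exp (-t) < 1 := exp_lt_one_iff.2 (by linarith)
  have hzt : 1 - t ≤ exp (-t) := one_sub_le_exp_neg t
  set z := exp (-t) with hzdef
  have hz0 : 0 < z := exp_pos _
  have ha2 : a ^ 2 ≤ 0.36 * t ^ 2 := by
    rw [← sq_abs]
    nlinarith [abs_nonneg a]
  have hcos := (abs_le.1 (cos_bound (x := a) (by linarith))).2
  have ha4 : |a| ^ 4 = a ^ 2 * a ^ 2 := by
    rw [← sq_abs]
    ring
  have ht2 : t ^ 2 ≤ 0.0005 := by nlinarith
  have hCa : 0.9999 * a ^ 2 ≤ 2 * C := by nlinarith [sq_nonneg a]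
  have hX : 0.9797 * a ^ 2 ≤ 2 * z * C := by nlinarith [sq_nonneg a]
  have h1 : (2 - t) / t ≤ (1 + z) / (1 - z) := by
    gcongr <;> linarith
  have h2 : 0.9797 * a ^ 2 / (1.3527 * t ^ 2) ≤ 2 * z * C / ((1 - z) ^ 2 + 2 * z * C) := by
    have h3 : (1 - z) ^ 2 ≤ t ^ 2 := pow_le_pow_left₀ (by linarith) (by linarith) 2
    have hX0 : 0 ≤ 2 * z * C := le_trans (by positivity) hX
    have hp : 0 < (1 - z) ^ 2 := by
      have : 0 < 1 - z := by linarith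
      positivity
    rw [div_le_div_iff₀ (by positivity) (by positivity)]
    nlinarith [mul_nonneg hX0 (sub_nonneg.2 ha2), mul_nonneg (sub_nonneg.2 hX) (sq_nonneg t),
      mul_nonneg (sq_nonneg a) (sub_nonneg.2 h3)]
  refine le_trans ?_ (mul_le_mul h1 h2 (by positivity) ?_)
  · rw [div_mul_div_comm, div_le_div_iff₀ (by positivity) (by positivity)]
    have : 0 ≤ a ^ 2 * t ^ 3 := by positivity
    nlinarith
  · exact div_nonneg (by linarith) (by linarith)

theorem exp_saddleRe_le_near {t θ : ℝ} (ht : 0 < t) (ht1 : t ≤ 0.0201) (hθ : |θ| ≤ 0.6 * t) :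
    exp (saddleRe t θ) ≤ exp (-(1.4161 / t ^ 3) * θ ^ 2) := by
  rw [exp_le_exp]
  refine (saddleRe_le ht θ).trans ?_
  have := kernel_ge ht ht1 hθ le_rfl
  rw [neg_mul, neg_le_neg_iff]
  refine le_trans (le_of_eq ?_) this
  ring

theorem exp_saddleRe_le_far {t θ : ℝ} (ht : 0 < t) (ht1 : t ≤ 0.0201) (hθ : 0.6 * t ≤ |θ|)
    (hθ' : |θ| ≤ π) : exp (saddleRe t θ) ≤ exp (-(0.5097 / t)) := by
  rw [exp_le_exp]
  refine (saddleRe_le ht θ).trans ?_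
  have hc : cos θ ≤ cos (0.6 * t) := by
    rw [← cos_abs θ]
    exact cos_le_cos_of_nonneg_of_le_pi (by positivity) hθ' hθ
  have := kernel_ge ht ht1 (a := 0.6 * t) (by rw [abs_of_pos (by positivity)])
    (sub_le_sub_left hc 1)
  rw [neg_le_neg_iff]
  refine le_trans ?_ this
  rw [div_le_div_iff₀ ht (by positivity)]
  have : 0 ≤ t ^ 3 := by positivity
  nlinarith

theorem exp_neg_div_le {t : ℝ} (ht : 0 < t) (ht1 : t ≤ 0.02004) :
    exp (-(0.5097 / t)) ≤ 0.004 * t ^ 5 := by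
  obtain ⟨x, hx⟩ : ∃ x, x = 1 / t := ⟨_, rfl⟩
  have hx49 : 49.9 ≤ x := by
    rw [hx, le_div_iff₀ ht]
    linarith
  have htx : t = 1 / x := by rw [hx, one_div_one_div]
  have hx0 : 0 < x := by linarith
  have hu : 0 ≤ x / 49.9 - 1 := by
    rw [sub_nonneg, le_div_iff₀ (by norm_num)]
    linarith
  have h1 : x ^ 5 ≤ 49.9 ^ 5 * exp (0.5097 * (x - 49.9)) := by
    have ha : x / 49.9 ≤ exp (x / 49.9 - 1) := by linarith [add_one_le_exp (x / 49.9 - 1)]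
    have hb := pow_le_pow_left₀ (by positivity) ha 5
    rw [div_pow, ← exp_nat_mul, div_le_iff₀ (by positivity), mul_comm] at hb
    refine hb.trans (mul_le_mul_of_nonneg_left (exp_le_exp.2 ?_) (by positivity))
    have hd : x / 49.9 = 10 / 499 * x := by
      rw [div_eq_mul_inv]
      norm_num
      ring
    rw [hd]
    norm_num
    linarith
  have h2 : (49.9 : ℝ) ^ 5 * 250 ≤ exp (0.5097 * 49.9) := by
    have ha : (1.5 : ℝ) ≤ exp 0.43 := by
      have := quadratic_le_exp_of_nonneg (x := 0.43) (by norm_num)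
      linarith
    have hb : (2.71828 : ℝ) ^ 25 ≤ exp 25 := by
      have h := exp_one_gt_d9
      have h25 : exp 25 = exp 1 ^ 25 := by rw [← exp_nat_mul]; norm_num
      rw [h25]
      exact pow_le_pow_left₀ (by norm_num) (by linarith) 25
    calc (49.9 : ℝ) ^ 5 * 250 ≤ 2.71828 ^ 25 * 1.5 := by norm_num
      _ ≤ exp 25 * exp 0.43 := by gcongr
      _ = exp 25.43 := by rw [← exp_add]; norm_num
      _ ≤ exp (0.5097 * 49.9) := exp_le_exp.2 (by norm_num)
  have h3 : 250 * x ^ 5 ≤ exp (0.5097 * x) := by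
    have : exp (0.5097 * x) = exp (0.5097 * 49.9) * exp (0.5097 * (x - 49.9)) := by
      rw [← exp_add]
      ring_nf
    rw [this]
    nlinarith [exp_pos (0.5097 * (x - 49.9))]
  rw [htx, div_div_eq_mul_div, div_one, exp_neg, one_div, inv_pow, show (0.004 : ℝ) = 250⁻¹ by norm_num,
    ← mul_inv]
  exact inv_anti₀ (by positivity) h3

theorem integrable_pow_mul_gaussian {a : ℝ} (ha : 0 < a) (k : ℕ) :
    Integrable fun x : ℝ ↦ x ^ k * exp (-a * x ^ 2) := by
  simpa using integrable_rpow_mul_exp_neg_mul_sq ha (s := k)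
    (by linarith [(Nat.cast_nonneg k : (0 : ℝ) ≤ k)])

theorem integral_pow_add_two_mul_gaussian {a : ℝ} (ha : 0 < a) (k : ℕ) :
    ∫ x : ℝ, x ^ (k + 2) * exp (-a * x ^ 2) =
      (k + 1) / (2 * a) * ∫ x : ℝ, x ^ k * exp (-a * x ^ 2) := by
  have hv : ∀ x : ℝ, HasDerivAt (fun x ↦ exp (-a * x ^ 2)) (exp (-a * x ^ 2) * (-a * (2 * x))) x := by
    intro x
    have h := ((hasDerivAt_pow 2 x).const_mul (-a)).exp
    simpa using h
  have hu : ∀ x : ℝ, HasDerivAt (fun x ↦ x ^ (k + 1)) ((k + 1 : ℝ) * x ^ k) x := by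
    intro x
    simpa using hasDerivAt_pow (k + 1) x
  have h := integral_mul_deriv_eq_deriv_mul_of_integrable (fun x _ ↦ hu x) (fun x _ ↦ hv x)
    (((integrable_pow_mul_gaussian ha (k + 2)).const_mul (-2 * a)).congr
      (Eventually.of_forall fun x ↦ by
        simp only [Pi.mul_apply]
        ring))
    (((integrable_pow_mul_gaussian ha k).const_mul (k + 1)).congr
      (Eventually.of_forall fun x ↦ by
        simp only [Pi.mul_apply]
        ring))
    (integrable_pow_mul_gaussian ha (k + 1))
  have h1 : ∀ x : ℝ, x ^ (k + 1) * (exp (-a * x ^ 2) * (-a * (2 * x))) =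
      (-2 * a) * (x ^ (k + 2) * exp (-a * x ^ 2)) := fun x ↦ by ring
  have h2 : ∀ x : ℝ, (k + 1 : ℝ) * x ^ k * exp (-a * x ^ 2) =
      (k + 1) * (x ^ k * exp (-a * x ^ 2)) := fun x ↦ by ring
  simp_rw [h1, h2, MeasureTheory.integral_const_mul] at h
  rw [div_mul_eq_mul_div, eq_div_iff (by positivity)]
  linarith

theorem integral_sq_mul_gaussian {a : ℝ} (ha : 0 < a) :
    ∫ x : ℝ, x ^ 2 * exp (-a * x ^ 2) = 1 / (2 * a) * √(π / a) := by
  rw [integral_pow_add_two_mul_gaussian ha 0, ← integral_gaussian]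
  simp

theorem integral_pow_four_mul_gaussian {a : ℝ} (ha : 0 < a) :
    ∫ x : ℝ, x ^ 4 * exp (-a * x ^ 2) = 3 / (4 * a ^ 2) * √(π / a) := by
  rw [integral_pow_add_two_mul_gaussian ha 2, integral_sq_mul_gaussian ha]
  field_simp
  norm_num

theorem integral_pow_six_mul_gaussian {a : ℝ} (ha : 0 < a) :
    ∫ x : ℝ, x ^ 6 * exp (-a * x ^ 2) = 15 / (8 * a ^ 3) * √(π / a) := by
  rw [integral_pow_add_two_mul_gaussian ha 4, integral_pow_four_mul_gaussian ha]
  field_simp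
  norm_num

theorem integral_le_gaussian_moment {a c d : ℝ} (ha : 0 < a) (hc : 0 ≤ c) {k : ℕ} (hk : Even k)
    {f : ℝ → ℝ} (hf : Continuous f)
    (h : ∀ x, |x| ≤ π → f x ≤ c * (x ^ k * exp (-a * x ^ 2)) + d) :
    ∫ x in -π..π, f x ≤ c * (∫ x : ℝ, x ^ k * exp (-a * x ^ 2)) + 2 * π * d := by
  have hpi := pi_pos
  have hcont : Continuous fun x : ℝ ↦ x ^ k * exp (-a * x ^ 2) := by fun_prop
  have h1 : ∫ x in -π..π, f x ≤ ∫ x in -π..π, (c * (x ^ k * exp (-a * x ^ 2)) + d) :=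
    intervalIntegral.integral_mono_on (by linarith) (hf.intervalIntegrable _ _)
      (((hcont.const_mul c).add continuous_const).intervalIntegrable _ _)
      fun x hx ↦ h x (abs_le.2 hx)
  have h2 : ∫ x in -π..π, x ^ k * exp (-a * x ^ 2) ≤ ∫ x : ℝ, x ^ k * exp (-a * x ^ 2) := by
    rw [intervalIntegral.integral_of_le (by linarith)]
    exact setIntegral_le_integral (integrable_pow_mul_gaussian ha k)
      (Eventually.of_forall fun x ↦ mul_nonneg (hk.pow_nonneg x) (exp_nonneg _))
  rw [intervalIntegral.integral_add ((hcont.const_mul c).intervalIntegrable _ _)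
    (continuous_const.intervalIntegrable _ _), intervalIntegral.integral_const_mul,
    intervalIntegral.integral_const, smul_eq_mul] at h1
  have h3 := mul_le_mul_of_nonneg_left h2 hc
  linarith

theorem integral_gaussian_Icc_ge {a : ℝ} (ha : 0 < a) :
    (1 - 1 / (2 * a * π ^ 2)) * √(π / a) ≤ ∫ x in -π..π, exp (-a * x ^ 2) := by
  have hpi := pi_pos
  have hi0 : Integrable fun x : ℝ ↦ exp (-a * x ^ 2) := integrable_exp_neg_mul_sq ha
  have hi2 := (integrable_pow_mul_gaussian ha 2).const_mul (1 / π ^ 2)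
  have hi : Integrable fun x : ℝ ↦
      exp (-a * x ^ 2) - 1 / π ^ 2 * (x ^ 2 * exp (-a * x ^ 2)) := hi0.sub hi2
  have hval : ∫ x : ℝ, (exp (-a * x ^ 2) - 1 / π ^ 2 * (x ^ 2 * exp (-a * x ^ 2))) =
      (1 - 1 / (2 * a * π ^ 2)) * √(π / a) := by
    rw [MeasureTheory.integral_sub hi0 hi2, MeasureTheory.integral_const_mul, integral_gaussian,
      integral_sq_mul_gaussian ha]
    field_simp
  rw [← hval, intervalIntegral.integral_of_le (by linarith),
    ← integral_add_compl (measurableSet_Ioc (a := -π) (b := π)) hi]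
  have h1 : ∫ x in Set.Ioc (-π) π, (exp (-a * x ^ 2) - 1 / π ^ 2 * (x ^ 2 * exp (-a * x ^ 2))) ≤
      ∫ x in Set.Ioc (-π) π, exp (-a * x ^ 2) :=
    setIntegral_mono hi.integrableOn hi0.integrableOn fun x ↦ sub_le_self _ (by positivity)
  have h2 : ∫ x in (Set.Ioc (-π) π)ᶜ,
      (exp (-a * x ^ 2) - 1 / π ^ 2 * (x ^ 2 * exp (-a * x ^ 2))) ≤ 0 := by
    refine setIntegral_nonpos measurableSet_Ioc.compl fun x hx ↦ ?_
    have hx2 : π ^ 2 ≤ x ^ 2 := by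
      rw [Set.mem_compl_iff, Set.mem_Ioc, not_and_or, not_lt, not_le] at hx
      rcases hx with hx | hx <;> nlinarith
    have hx3 : 1 ≤ 1 / π ^ 2 * x ^ 2 := by
      rw [one_div_mul_eq_div, le_div_iff₀ (by positivity)]
      linarith
    nlinarith [exp_pos (-a * x ^ 2)]
  exact (add_le_add h1 h2).trans_eq (add_zero _)

theorem oddCumulant_two_le {t : ℝ} (ht : 0 < t) : oddCumulant 2 t ≤ 5 / t ^ 3 := by
  refine (oddCumulant_le ht fun y hy ↦ tsum_succ_pow_two_le hy).trans ?_
  norm_num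
  gcongr
  nlinarith [pi_lt_d2, pi_pos]

theorem oddCumulant_three_le {t : ℝ} (ht : 0 < t) : oddCumulant 3 t ≤ 16.45 / t ^ 4 := by
  refine (oddCumulant_le ht fun y hy ↦ tsum_succ_pow_three_le hy).trans ?_
  norm_num
  gcongr
  nlinarith [pi_lt_d4, pi_pos]

theorem exp_saddleRe_mul_le {t θ c d b : ℝ} {k : ℕ} (ht : 0 < t) (ht1 : t ≤ 0.02004)
    (hθ : |θ| ≤ π) (hk : Even k) (hc : 0 ≤ c) (hd : 0 ≤ d) (hb0 : 0 ≤ b) (hb : b ≤ c * θ ^ k)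
    (hbd : b ≤ d) :
    exp (saddleRe t θ) * b ≤
      c * (θ ^ k * exp (-(1.4161 / t ^ 3) * θ ^ 2)) + d * (0.004 * t ^ 5) := by
  have hθk := hk.pow_nonneg θ
  rcases le_total |θ| (0.6 * t) with h | h
  · have h1 := exp_saddleRe_le_near ht (by linarith) h
    have h2 := mul_le_mul h1 hb hb0 (exp_nonneg _)
    have h3 : 0 ≤ d * (0.004 * t ^ 5) := by positivity
    linarith
  · have h1 := (exp_saddleRe_le_far ht (by linarith) h hθ).trans (exp_neg_div_le ht ht1)
    have h2 := mul_le_mul h1 hbd hb0 (by positivity)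
    have h3 : 0 ≤ c * (θ ^ k * exp (-(1.4161 / t ^ 3) * θ ^ 2)) := by positivity
    linarith

/-- The normalized overpartition number `pbar k * e ^ (-k * t) / F(e ^ (-t))`, where `F` is the
generating function of overpartitions. -/
noncomputable def saddleWeight (t : ℝ) (k : ℕ) : ℝ :=
  (pbar k : ℝ) * exp (-t) ^ k / exp (oddCumulant 0 t)

theorem two_pi_mul_saddleWeight {t : ℝ} (ht : 0 < t) (k : ℕ) :
    2 * π * saddleWeight t k =
      ∫ θ in -π..π, exp (saddleRe t θ) * cos (saddleIm t θ - k * θ) := by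
  rw [saddleWeight, mul_div_assoc', two_pi_mul_pbar ht, mul_div_cancel_left₀ _ (exp_ne_zero _)]

theorem sqrt_pi_div_ge {t : ℝ} (ht : 0 < t) (ht1 : t ≤ 0.02004) :
    10 * t ^ 2 ≤ √(π / (1.4161 / t ^ 3)) := by
  apply le_sqrt_of_sq_le
  rw [div_div_eq_mul_div, le_div_iff₀ (by norm_num)]
  have := pi_gt_d2
  have h3 : 0 < t ^ 3 := by positivity
  nlinarith

section SaddlePoint

variable {t : ℝ} {n : ℕ}

theorem abs_phase_le (ht : 0 < t) (hn : oddCumulant 1 t = n) (θ : ℝ) :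
    |saddleIm t θ - n * θ| ≤ 16.45 / t ^ 4 * |θ| ^ 3 / 6 := by
  rw [← hn]
  refine (abs_saddleIm_sub_le ht θ).trans ?_
  gcongr
  exact oddCumulant_three_le ht

theorem integral_exp_saddleRe_ge (ht : 0 < t) (ht1 : t ≤ 0.02004) :
    0.7525 * √(π / (1.4161 / t ^ 3)) ≤ ∫ θ in -π..π, exp (saddleRe t θ) := by
  have hpi := pi_gt_d2
  have ha : 0 < 2.5 / t ^ 3 := by positivity
  have h1 : ∫ θ in -π..π, exp (-(2.5 / t ^ 3) * θ ^ 2) ≤ ∫ θ in -π..π, exp (saddleRe t θ) := by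
    refine intervalIntegral.integral_mono_on (by linarith)
      ((by fun_prop : Continuous fun θ : ℝ ↦ exp (-(2.5 / t ^ 3) * θ ^ 2)).intervalIntegrable _ _)
      ((continuous_saddleRe ht).rexp.intervalIntegrable _ _) fun θ _ ↦ exp_le_exp.2 ?_
    refine le_trans ?_ (saddleRe_ge ht θ)
    have h := mul_le_mul_of_nonneg_right (oddCumulant_two_le ht) (by positivity : 0 ≤ θ ^ 2 / 2)
    have he : -(2.5 / t ^ 3) * θ ^ 2 = -(5 / t ^ 3 * (θ ^ 2 / 2)) := by ring
    rw [he]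
    linarith
  refine le_trans ?_ ((integral_gaussian_Icc_ge ha).trans h1)
  have h2 : 0.7526 * √(π / (1.4161 / t ^ 3)) ≤ √(π / (2.5 / t ^ 3)) := by
    apply le_sqrt_of_sq_le
    rw [mul_pow, sq_sqrt (by positivity), div_div_eq_mul_div, div_div_eq_mul_div, mul_div_assoc',
      div_le_div_iff₀ (by norm_num) (by norm_num)]
    have : 0 < π * t ^ 3 := by positivity
    linarith
  have h3 : 1 / (2 * (2.5 / t ^ 3) * π ^ 2) ≤ 0.0001 := by
    rw [div_le_iff₀ (by positivity)]
    have h5 : 125 ≤ 2.5 / t ^ 3 := by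
      rw [le_div_iff₀ (by positivity)]
      have : t ^ 3 ≤ 0.02004 ^ 3 := pow_le_pow_left₀ ht.le ht1 3
      norm_num at this
      linarith
    have h6 : 9 ≤ π ^ 2 := by nlinarith
    have h7 : 50000 ≤ 2.5 / t ^ 3 := by
      rw [le_div_iff₀ (by positivity)]
      have : t ^ 3 ≤ 0.02004 ^ 3 := pow_le_pow_left₀ ht.le ht1 3
      norm_num at this
      linarith
    nlinarith
  have h4 : 0 ≤ √(π / (1.4161 / t ^ 3)) := sqrt_nonneg _
  have h5 : 0.9999 * √(π / (2.5 / t ^ 3)) ≤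
      (1 - 1 / (2 * (2.5 / t ^ 3) * π ^ 2)) * √(π / (2.5 / t ^ 3)) :=
    mul_le_mul_of_nonneg_right (by linarith) (sqrt_nonneg _)
  linarith

theorem saddleWeight_ge (ht : 0 < t) (ht1 : t ≤ 0.02004) (hn : oddCumulant 1 t = n) :
    0.702 * √(π / (1.4161 / t ^ 3)) ≤ 2 * π * saddleWeight t n := by
  have hcR := continuous_saddleRe ht
  have hcI := continuous_saddleIm ht
  have hsplit : 2 * π * saddleWeight t n = (∫ θ in -π..π, exp (saddleRe t θ)) -
      ∫ θ in -π..π, exp (saddleRe t θ) * (1 - cos (saddleIm t θ - n * θ)) := by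
    rw [two_pi_mul_saddleWeight ht, ← intervalIntegral.integral_sub]
    · refine intervalIntegral.integral_congr fun θ _ ↦ ?_
      ring
    · exact (by fun_prop : Continuous fun θ ↦ exp (saddleRe t θ)).intervalIntegrable _ _
    · exact (by fun_prop : Continuous fun θ ↦
        exp (saddleRe t θ) * (1 - cos (saddleIm t θ - n * θ))).intervalIntegrable _ _
  have ha : 0 < 1.4161 / t ^ 3 := by positivity
  have hupper := integral_le_gaussian_moment ha (c := (16.45 / t ^ 4) ^ 2 / 72)
    (d := 2 * (0.004 * t ^ 5)) (k := 6) (by positivity) (by decide)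
    (f := fun θ ↦ exp (saddleRe t θ) * (1 - cos (saddleIm t θ - n * θ))) (by fun_prop)
    fun θ hθ ↦ exp_saddleRe_mul_le ht ht1 hθ (by decide) (by positivity) zero_le_two
      (by linarith [cos_le_one (saddleIm t θ - n * θ)])
      (by
        have h1 := one_sub_sq_div_two_le_cos (x := saddleIm t θ - n * θ)
        have h2 := pow_le_pow_left₀ (abs_nonneg _) (abs_phase_le ht hn θ) 2
        rw [sq_abs, div_pow, mul_pow, ← pow_mul, Even.pow_abs (by decide)] at h2
        linarith)
      (by linarith [neg_one_le_cos (saddleIm t θ - n * θ)])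
  rw [integral_pow_six_mul_gaussian ha] at hupper
  have hlower := integral_exp_saddleRe_ge ht ht1
  have hg := sqrt_pi_div_ge ht ht1
  set g := √(π / (1.4161 / t ^ 3))
  have hg0 : 0 < g := lt_of_lt_of_le (by positivity) hg
  have h1 : (16.45 / t ^ 4) ^ 2 / 72 * (15 / (8 * (1.4161 / t ^ 3) ^ 3) * g) ≤ 0.04985 * g := by
    have he : (16.45 / t ^ 4) ^ 2 / 72 * (15 / (8 * (1.4161 / t ^ 3) ^ 3) * g) =
        16.45 ^ 2 / 72 * (15 / (8 * 1.4161 ^ 3)) * (t * g) := by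
      field_simp
    rw [he]
    have : t * g ≤ 0.02004 * g := by gcongr
    have h2 : (16.45 ^ 2 / 72 * (15 / (8 * 1.4161 ^ 3)) : ℝ) ≤ 2.4855 := by norm_num
    nlinarith
  have h2 : 2 * π * (2 * (0.004 * t ^ 5)) ≤ 0.0001 * g := by
    have hpi := pi_lt_d2
    have h3 : t ^ 3 ≤ 0.02004 ^ 3 := pow_le_pow_left₀ ht.le ht1 3
    have h4 : t ^ 5 ≤ 0.00001 * t ^ 2 := by
      norm_num at h3
      nlinarith [sq_nonneg t]
    have h5 : 0 < t ^ 5 := by positivity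
    nlinarith
  rw [hsplit]
  linarith

theorem saddleWeight_second_difference_le (hn0 : 1 ≤ n) (ht : 0 < t) (ht1 : t ≤ 0.02004) :
    2 * π * (2 * saddleWeight t n - saddleWeight t (n + 1) - saddleWeight t (n - 1)) ≤
      0.364 * t ^ 3 * √(π / (1.4161 / t ^ 3)) := by
  have hcR := continuous_saddleRe ht
  have hcI := continuous_saddleIm ht
  have hi : ∀ k : ℕ, IntervalIntegrable
      (fun θ ↦ exp (saddleRe t θ) * cos (saddleIm t θ - k * θ)) volume (-π) π := fun k ↦
    (by fun_prop : Continuous fun θ ↦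
      exp (saddleRe t θ) * cos (saddleIm t θ - k * θ)).intervalIntegrable _ _
  have hsplit : 2 * π * (2 * saddleWeight t n - saddleWeight t (n + 1) - saddleWeight t (n - 1)) =
      ∫ θ in -π..π, exp (saddleRe t θ) * (cos (saddleIm t θ - n * θ) * (2 * (1 - cos θ))) := by
    have he : 2 * π * (2 * saddleWeight t n - saddleWeight t (n + 1) - saddleWeight t (n - 1)) =
        2 * (2 * π * saddleWeight t n) - 2 * π * saddleWeight t (n + 1) -
          2 * π * saddleWeight t (n - 1) := by ring
    rw [he, two_pi_mul_saddleWeight ht, two_pi_mul_saddleWeight ht, two_pi_mul_saddleWeight ht,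
      ← intervalIntegral.integral_const_mul, ← intervalIntegral.integral_sub ((hi n).const_mul 2)
      (hi _), ← intervalIntegral.integral_sub (((hi n).const_mul 2).sub (hi _)) (hi _)]
    refine intervalIntegral.integral_congr fun θ _ ↦ ?_
    have h1 : saddleIm t θ - (n + 1 : ℕ) * θ = (saddleIm t θ - n * θ) - θ := by
      push_cast
      ring
    have h2 : saddleIm t θ - (n - 1 : ℕ) * θ = (saddleIm t θ - n * θ) + θ := by
      rw [Nat.cast_sub hn0]
      push_cast
      ring
    rw [h1, h2, cos_sub _ θ, cos_add _ θ]
    ring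
  have ha : 0 < 1.4161 / t ^ 3 := by positivity
  have hupper := integral_le_gaussian_moment ha (c := 1)
    (d := 4 * (0.004 * t ^ 5)) (k := 2) zero_le_one (by decide)
    (f := fun θ ↦ exp (saddleRe t θ) * (cos (saddleIm t θ - n * θ) * (2 * (1 - cos θ))))
    (by fun_prop)
    fun θ hθ ↦ by
      have hc := cos_le_one θ
      refine le_trans ?_ (exp_saddleRe_mul_le ht ht1 (b := 2 * (1 - cos θ)) hθ (by decide)
        zero_le_one zero_le_four (by linarith)
        (by linarith [one_sub_sq_div_two_le_cos (x := θ)]) (by linarith [neg_one_le_cos θ]))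
      refine mul_le_mul_of_nonneg_left ?_ (exp_nonneg _)
      exact mul_le_of_le_one_left (by linarith) (cos_le_one _)
  rw [integral_sq_mul_gaussian ha] at hupper
  have hg := sqrt_pi_div_ge ht ht1
  set g := √(π / (1.4161 / t ^ 3))
  have hg0 : 0 < g := lt_of_lt_of_le (by positivity) hg
  have h1 : 1 / (2 * (1.4161 / t ^ 3)) * g ≤ 0.3532 * t ^ 3 * g := by
    refine mul_le_mul_of_nonneg_right ?_ hg0.le
    rw [div_le_iff₀ (by positivity)]
    field_simp
    norm_num
  have h2 : 2 * π * (4 * (0.004 * t ^ 5)) ≤ 0.0102 * t ^ 3 * (10 * t ^ 2) := by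
    have hpi := pi_lt_d2
    have h5 : 0 < t ^ 5 := by positivity
    nlinarith
  have h3 : 0.0102 * t ^ 3 * (10 * t ^ 2) ≤ 0.0102 * t ^ 3 * g := by gcongr
  have h4 : 0 < t ^ 3 * g := by positivity
  rw [hsplit]
  linarith

theorem abs_saddleWeight_sub_le (hn0 : 1 ≤ n) (ht : 0 < t) (ht1 : t ≤ 0.02004)
    (hn : oddCumulant 1 t = n) :
    |2 * π * (saddleWeight t (n + 1) - saddleWeight t (n - 1))| ≤
      2.052 * t ^ 2 * √(π / (1.4161 / t ^ 3)) := by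
  have hcR := continuous_saddleRe ht
  have hcI := continuous_saddleIm ht
  have hi : ∀ k : ℕ, IntervalIntegrable
      (fun θ ↦ exp (saddleRe t θ) * cos (saddleIm t θ - k * θ)) volume (-π) π := fun k ↦
    (by fun_prop : Continuous fun θ ↦
      exp (saddleRe t θ) * cos (saddleIm t θ - k * θ)).intervalIntegrable _ _
  have hsplit : 2 * π * (saddleWeight t (n + 1) - saddleWeight t (n - 1)) =
      ∫ θ in -π..π, exp (saddleRe t θ) * (2 * (sin (saddleIm t θ - n * θ) * sin θ)) := by
    rw [mul_sub, two_pi_mul_saddleWeight ht, two_pi_mul_saddleWeight ht,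
      ← intervalIntegral.integral_sub (hi _) (hi _)]
    refine intervalIntegral.integral_congr fun θ _ ↦ ?_
    have h1 : saddleIm t θ - (n + 1 : ℕ) * θ = (saddleIm t θ - n * θ) - θ := by
      push_cast
      ring
    have h2 : saddleIm t θ - (n - 1 : ℕ) * θ = (saddleIm t θ - n * θ) + θ := by
      rw [Nat.cast_sub hn0]
      push_cast
      ring
    rw [h1, h2, cos_sub _ θ, cos_add _ θ]
    ring
  have ha : 0 < 1.4161 / t ^ 3 := by positivity
  have hupper := integral_le_gaussian_moment ha (c := 16.45 / t ^ 4 / 3)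
    (d := 2 * (0.004 * t ^ 5)) (k := 4) (by positivity) (by decide)
    (f := fun θ ↦ exp (saddleRe t θ) * (2 * (|sin (saddleIm t θ - n * θ)| * |sin θ|)))
    (by fun_prop)
    fun θ hθ ↦ by
      refine exp_saddleRe_mul_le ht ht1 hθ (by decide) (by positivity) zero_le_two
        (by positivity) ?_ ?_
      · have h1 : |sin (saddleIm t θ - n * θ)| ≤ 16.45 / t ^ 4 * |θ| ^ 3 / 6 :=
          abs_sin_le_abs.trans (abs_phase_le ht hn θ)
        have h2 := mul_le_mul h1 (abs_sin_le_abs (x := θ)) (abs_nonneg _) (by positivity)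
        have h3 : |θ| ^ 4 = θ ^ 4 := Even.pow_abs (by decide) θ
        rw [← h3]
        linarith
      · have := mul_le_one₀ (abs_sin_le_one (saddleIm t θ - n * θ)) (abs_nonneg _)
          (abs_sin_le_one θ)
        linarith
  rw [integral_pow_four_mul_gaussian ha] at hupper
  have hg := sqrt_pi_div_ge ht ht1
  set g := √(π / (1.4161 / t ^ 3))
  have hg0 : 0 < g := lt_of_lt_of_le (by positivity) hg
  have h1 : 16.45 / t ^ 4 / 3 * (3 / (4 * (1.4161 / t ^ 3) ^ 2) * g) ≤ 2.051 * t ^ 2 * g := by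
    have he : 16.45 / t ^ 4 / 3 * (3 / (4 * (1.4161 / t ^ 3) ^ 2) * g) =
        16.45 / (4 * 1.4161 ^ 2) * (t ^ 2 * g) := by
      field_simp
    rw [he, mul_assoc]
    refine mul_le_mul_of_nonneg_right ?_ (by positivity)
    norm_num
  have h2 : 2 * π * (2 * (0.004 * t ^ 5)) ≤ 0.001 * t ^ 2 * (10 * t ^ 2) := by
    have hpi := pi_lt_d2
    have h5 : t ^ 5 ≤ 0.02004 * t ^ 4 := by
      rw [pow_succ']
      gcongr
    have h6 : π * t ^ 5 ≤ 3.15 * (0.02004 * t ^ 4) := by gcongr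
    have h7 : 0 < t ^ 4 := by positivity
    linarith
  have h3 : 0.001 * t ^ 2 * (10 * t ^ 2) ≤ 0.001 * t ^ 2 * g := by gcongr
  rw [hsplit]
  refine (intervalIntegral.abs_integral_le_integral_abs (by linarith [pi_pos])).trans ?_
  simp only [abs_mul, abs_exp, abs_two]
  linarith

end SaddlePoint

end Fourier

section Assembly

theorem oddCumulant_zero_le {t : ℝ} (ht : 0 < t) : oddCumulant 0 t ≤ π ^ 2 / 4 / t := by
  refine (oddCumulant_le ht fun y hy ↦ tsum_succ_pow_zero_le hy).trans ?_
  simp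

theorem oddCumulant_one_le {t : ℝ} (ht : 0 < t) : oddCumulant 1 t ≤ π ^ 2 / 4 / t ^ 2 := by
  refine (oddCumulant_le ht fun y hy ↦ tsum_succ_pow_one_le hy).trans ?_
  simp

theorem pbar_le_exp (n : ℕ) {t : ℝ} (ht : 0 < t) : (pbar n : ℝ) ≤ exp (π ^ 2 / 4 / t + n * t) := by
  have h1 : (pbar n : ℝ) * exp (-t) ^ n ≤ exp (oddCumulant 0 t) :=
    le_hasSum (hasSum_pbar_mul_exp ht) n fun m _ ↦ by positivity
  have h2 : exp (-t) ^ n = (exp (n * t))⁻¹ := by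
    rw [← exp_nat_mul, ← exp_neg]
    congr 1
    ring
  rw [h2, ← div_eq_mul_inv, div_le_iff₀ (exp_pos _)] at h1
  refine h1.trans ?_
  rw [exp_add]
  gcongr
  exact oddCumulant_zero_le ht

theorem pbar_lt_base {n : ℕ} (hn : n < cutoff) : pbar n < base := by
  have hn' : (n : ℝ) ≤ 6159 := by
    have : n ≤ 6159 := Nat.le_of_lt_succ hn
    exact_mod_cast this
  have h1 := pbar_le_exp n (t := 1 / 50) (by norm_num)
  have h2 : π ^ 2 / 4 / (1 / 50) + n * (1 / 50) ≤ (248 : ℕ) * 1 := by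
    have := pi_lt_d4
    have := pi_pos
    push_cast
    nlinarith
  have h3 : exp ((248 : ℕ) * 1) < (2 : ℝ) ^ 384 := by
    have h : exp 1 ^ 2 ≤ 2 ^ 3 :=
      (pow_le_pow_left₀ (exp_nonneg _) exp_one_lt_d9.le 2).trans (by norm_num)
    rw [exp_nat_mul, show 248 = 2 * 124 by norm_num, pow_mul]
    refine (pow_le_pow_left₀ (by positivity) h 124).trans_lt ?_
    rw [← pow_mul]
    exact pow_lt_pow_right₀ one_lt_two (by norm_num)
  have h4 : (pbar n : ℝ) < ((2 ^ 384 : ℕ) : ℝ) := by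
    rw [Nat.cast_pow]
    exact (h1.trans (exp_le_exp.2 h2)).trans_lt (by exact_mod_cast h3)
  rw [base]
  exact_mod_cast h4

theorem saddleWeight_pos (t : ℝ) (k : ℕ) : 0 < saddleWeight t k := by
  have : (0 : ℝ) < pbar k := by exact_mod_cast pbar_pos k
  unfold saddleWeight
  positivity

theorem log_pbar_eq (t : ℝ) (k : ℕ) :
    log (pbar k) = log (saddleWeight t k) + k * t + oddCumulant 0 t := by
  have : (0 : ℝ) < pbar k := by exact_mod_cast pbar_pos k
  rw [saddleWeight, log_div (by positivity) (by positivity), log_mul (by positivity)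
    (by positivity), log_pow, log_exp, log_exp]
  ring

theorem neg_div_sub_three_le_log {t : ℝ} (ht : 0 < t) : -(0.02 / t) - 3 ≤ log t := by
  have h1 := log_le_sub_one_of_pos (x := 1 / (50 * t)) (by positivity)
  have h2 : log 50 ≤ 4 := by
    rw [log_le_iff_le_exp (by norm_num), show (4 : ℝ) = (4 : ℕ) * 1 by norm_num, exp_nat_mul]
    refine le_trans ?_ (pow_le_pow_left₀ (by norm_num) exp_one_gt_d9.le 4)
    norm_num
  rw [one_div, log_inv, log_mul (by norm_num) ht.ne'] at h1
  have h3 : (50 * t)⁻¹ = 0.02 / t := by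
    field_simp
    norm_num
  linarith

theorem log_mul_ge_of_near {P Q R t : ℝ} (ht : 0 < t) (ht1 : t ≤ 0.02004) (hP : 0 < P) (hQ : 0 < Q)
    (hR : 0 < R) (h2 : 2 * P - Q - R ≤ 0.52 * t ^ 3 * P) (h1 : |Q - R| ≤ 2.924 * t ^ 2 * P) :
    -(0.521 * t ^ 3 + 2.15 * t ^ 4) ≤ log Q + log R - 2 * log P := by
  have h3 : t ^ 3 ≤ 0.00001 := by
    have := pow_le_pow_left₀ ht.le ht1 3
    norm_num at this
    linarith
  have h4 : t ^ 4 ≤ 0.00001 := by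
    have := pow_le_pow_left₀ ht.le ht1 4
    norm_num at this
    linarith
  have h5 : 0 < t ^ 3 := by positivity
  have h6 : 0 < t ^ 4 := by positivity
  set δ := 0.52 * t ^ 3 + 2.14 * t ^ 4 with hδ
  have hδ0 : 0 < δ := by positivity
  have hδ1 : δ ≤ 0.0001 := by linarith
  have hprod : (1 - δ) * P ^ 2 ≤ Q * R := by
    have hs : (2 - 0.52 * t ^ 3) * P ≤ Q + R := by linarith
    have hs2 := pow_le_pow_left₀ (mul_nonneg (by linarith) hP.le) hs 2
    have hd2 := pow_le_pow_left₀ (abs_nonneg _) h1 2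
    rw [sq_abs] at hd2
    have hp : 0 ≤ (t ^ 3) ^ 2 * P ^ 2 := by positivity
    have hp' : 0 ≤ t ^ 4 * P ^ 2 := by positivity
    have he : 4 * (Q * R) = (Q + R) ^ 2 - (Q - R) ^ 2 := by ring
    rw [hδ]
    nlinarith
  have hlog := log_le_log (mul_pos (by linarith) (by positivity)) hprod
  rw [log_mul (by linarith) (by positivity), log_mul hQ.ne' hR.ne', log_pow] at hlog
  have hlow := one_sub_inv_le_log_of_pos (show 0 < 1 - δ by linarith)
  have hinv : (1 - δ)⁻¹ ≤ 1 + 1.001 * δ := by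
    rw [inv_le_iff_one_le_mul₀ (by linarith)]
    nlinarith
  push_cast at hlog
  linarith

theorem log_sub_log_le_of_near {P Q R t : ℝ} (ht : 0 < t) (ht1 : t ≤ 0.02004) (hP : 0 < P)
    (hQ : 0 < Q) (hR : 0 < R) (h2 : 2 * P - Q - R ≤ 0.52 * t ^ 3 * P)
    (h1 : |Q - R| ≤ 2.924 * t ^ 2 * P) :
    log Q - log R ≤ 2.96 * t ^ 2 := by
  have hle := (abs_le.1 h1).2
  have h3 : t ^ 3 ≤ 0.00001 := by
    have := pow_le_pow_left₀ ht.le ht1 3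
    norm_num at this
    linarith
  have h4 : t ^ 2 ≤ 0.00041 := by
    have := pow_le_pow_left₀ ht.le ht1 2
    norm_num at this
    linarith
  have hR1 : 0.99 * P ≤ R := by
    have ha : t ^ 3 * P ≤ 0.00001 * P := by gcongr
    have hb : t ^ 2 * P ≤ 0.00041 * P := by gcongr
    linarith
  have hlog := log_le_sub_one_of_pos (div_pos hQ hR)
  rw [log_div hQ.ne' hR.ne'] at hlog
  refine hlog.trans ?_
  rw [sub_le_iff_le_add, div_le_iff₀ hR]
  have : t ^ 2 * (0.99 * P) ≤ t ^ 2 * R := by gcongr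
  have : 0 ≤ t ^ 2 * P := by positivity
  linarith

theorem two_mul_log_saddleWeight_ge {t P : ℝ} (ht : 0 < t) (hP : 0 < P)
    (h : 0.702 * √(π / (1.4161 / t ^ 3)) ≤ 2 * π * P) : 3 * log t - 4 ≤ 2 * log P := by
  have h1 := pow_le_pow_left₀ (by positivity) h 2
  rw [mul_pow, sq_sqrt (by positivity), div_div_eq_mul_div, mul_div_assoc',
    div_le_iff₀ (by norm_num)] at h1
  have hexp : exp (-4) ≤ 0.0276 := by
    rw [exp_neg, inv_le_comm₀ (exp_pos _) (by norm_num), show (4 : ℝ) = (4 : ℕ) * 1 by norm_num,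
      exp_nat_mul]
    refine le_trans ?_ (pow_le_pow_left₀ (by norm_num) exp_one_gt_d9.le 4)
    norm_num
  have hmain : t ^ 3 * exp (-4) ≤ P ^ 2 := by
    have h2 : 0.347 * t ^ 3 ≤ 4 * π * P ^ 2 := by
      have h4 : 0 < π * t ^ 3 := by positivity
      refine le_of_mul_le_mul_left ?_ pi_pos
      linarith
    have h3 : 4 * π * P ^ 2 ≤ 12.57 * P ^ 2 := by
      gcongr
      linarith [pi_lt_d4]
    have h5 : t ^ 3 * exp (-4) ≤ t ^ 3 * 0.0276 := by gcongr
    have h6 : 0 < t ^ 3 := by positivity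
    linarith
  have := log_le_log (by positivity) hmain
  rw [log_mul (by positivity) (exp_ne_zero _), log_pow, log_pow, log_exp] at this
  push_cast at this
  linarith

theorem gap_of_large {n : ℕ} (hn : 6148 ≤ n) :
    2 * log n < (n : ℝ) ^ 2 * (log (pbar (n + 1)) + log (pbar (n - 1)) - 2 * log (pbar n)) -
      n * (log (pbar (n + 1)) - log (pbar (n - 1))) + 2 * log (pbar n) := by
  obtain ⟨t, ht, hcum⟩ := exists_oddCumulant_one_eq (show 2 ≤ n by omega)
  have hn0 : 1 ≤ n := by omega
  have hnR : (6148 : ℝ) ≤ n := by exact_mod_cast hn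
  have hnt : n * t ^ 2 ≤ 2.46745 := by
    have h1 := oddCumulant_one_le ht
    rw [hcum, le_div_iff₀ (by positivity)] at h1
    have := pi_lt_d6
    have := pi_pos
    nlinarith
  have ht1 : t ≤ 0.02004 := by
    by_contra! h
    have h1 : (0.02004 : ℝ) ^ 2 < t ^ 2 := pow_lt_pow_left₀ h (by norm_num) two_ne_zero
    nlinarith
  have hP := saddleWeight_pos t n
  have hQ := saddleWeight_pos t (n + 1)
  have hR := saddleWeight_pos t (n - 1)
  have hge := saddleWeight_ge ht ht1 hcum
  have hsecond := saddleWeight_second_difference_le hn0 ht ht1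
  have hfirst := abs_saddleWeight_sub_le hn0 ht ht1 hcum
  have hpeak := two_mul_log_saddleWeight_ge ht hP hge
  rw [log_pbar_eq t n, log_pbar_eq t (n + 1), log_pbar_eq t (n - 1), Nat.cast_sub hn0]
  push_cast
  rw [abs_mul, abs_of_pos two_pi_pos] at hfirst
  generalize saddleWeight t n = P at *
  generalize saddleWeight t (n + 1) = Q at *
  generalize saddleWeight t (n - 1) = R at *
  generalize √(π / (1.4161 / t ^ 3)) = g at *
  have hsecond' : 2 * P - Q - R ≤ 0.52 * t ^ 3 * P := by
    refine le_of_mul_le_mul_left (hsecond.trans ?_) two_pi_pos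
    have h1 := mul_le_mul_of_nonneg_left hge (pow_nonneg ht.le 3)
    have h2 : 0 ≤ t ^ 3 * (2 * π * P) := by positivity
    linarith
  have hfirst' : |Q - R| ≤ 2.924 * t ^ 2 * P := by
    refine le_of_mul_le_mul_left (hfirst.trans ?_) two_pi_pos
    have h1 := mul_le_mul_of_nonneg_left hge (pow_nonneg ht.le 2)
    have h2 : 0 ≤ t ^ 2 * (2 * π * P) := by positivity
    linarith
  have hconv := log_mul_ge_of_near ht ht1 hP hQ hR hsecond' hfirst'
  have hslope := log_sub_log_le_of_near ht ht1 hP hQ hR hsecond' hfirst'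
  have hnt2 : (n : ℝ) ^ 2 * t ^ 4 ≤ 6.0884 := by
    have h1 := pow_le_pow_left₀ (by positivity) hnt 2
    norm_num at h1
    linarith
  have hconv' : -(3.173 / t + 13.1) ≤ (n : ℝ) ^ 2 * (log Q + log R - 2 * log P) := by
    refine le_trans ?_ (mul_le_mul_of_nonneg_left hconv (by positivity))
    have h1 : (n : ℝ) ^ 2 * t ^ 3 ≤ 6.0884 / t := by
      rw [le_div_iff₀ ht]
      linarith
    have h2 : 3.173 / t = 0.521 * (6.0884 / t) + 0.0009436 / t := by
      field_simp
      norm_num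
    have h3 : 0 < 0.0009436 / t := by positivity
    linarith
  have hslope' : n * (log Q - log R) ≤ 7.31 := by
    refine (mul_le_mul_of_nonneg_left hslope (by positivity)).trans ?_
    linarith
  have hlogn : 2 * log n ≤ 2 - 4 * log t := by
    have h1 := log_le_log (by positivity) hnt2
    rw [log_mul (by positivity) (by positivity), log_pow, log_pow] at h1
    have h2 : log 6.0884 ≤ 2 := by
      rw [log_le_iff_le_exp (by norm_num), show (2 : ℝ) = (2 : ℕ) * 1 by norm_num, exp_nat_mul]
      refine le_trans ?_ (pow_le_pow_left₀ (by norm_num) exp_one_gt_d9.le 2)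
      norm_num
    push_cast at h1
    linarith
  have hcum0 := oddCumulant_zero_ge ht
  have hlogt := neg_div_sub_three_le_log ht
  have hinv : 49 ≤ 1 / t := by
    rw [le_div_iff₀ ht]
    linarith
  have hx : ∀ c : ℝ, c / t = c * (1 / t) := fun c ↦ by ring
  rw [hx] at hconv' hcum0 hlogt
  linarith

theorem rseq_sq_lt {n : ℕ} (hn : 4 ≤ n) :
    rseq 0 n ^ 2 < rseq 0 (n - 1) * rseq 0 (n + 1) ∧
      (19 ≤ n → rseq 1 n ^ 2 < rseq 1 (n - 1) * rseq 1 (n + 1)) := by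
  rcases lt_or_ge n 6148 with h | h
  · exact rseq_of_leafTest (by omega) (leafTest_pbar (fun _ hk ↦ pbar_lt_base hk) hn h)
  · obtain ⟨h0, h1⟩ := rseq_sq_lt_of_gap (by omega) (gap_of_large h)
    exact ⟨h0, fun _ ↦ h1⟩

end Assembly

theorem stmt2 :
    (∀ n : ℕ, 4 ≤ n → (rseq 0 n) ^ 2 < rseq 0 (n - 1) * rseq 0 (n + 1)) ∧
    (∀ n : ℕ, 19 ≤ n → (rseq 1 n) ^ 2 < rseq 1 (n - 1) * rseq 1 (n + 1)) :=
  ⟨fun _ hn ↦ (rseq_sq_lt hn).1, fun _ hn ↦ (rseq_sq_lt ((by norm_num : 4 ≤ 19).trans hn)).2 hn⟩
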